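/- arXiv:2509.04920 — 2 statements merged into one kernel-verified Lean document; each statement's English description precedes it below -/
import Mathlib

section
/- Let k, l ∈ ℕ and let K be a compact subset of (0,2). Then there exists C > 0 such that for all α ∈ K and all y ∈ ℝ: |𝓘_α^{(k,l)}(y)| ≤ C ψ_α^{(l)}(y), and (1/C) ψ_α^{(0)}(y) ≤ 𝓘_α^{(0,0)}(y) ≤ C ψ_α^{(0)}(y). -/
open MeasureTheory Filter Set Topology Matrix

noncomputable section

namespace LevyLAN

/-- Standard Gaussian density `φ`. -/
def gauss (y : ℝ) : ℝ := (Real.sqrt (2 * Real.pi))⁻¹ * Real.exp (-(y ^ 2) / 2)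

/-- Symmetric `α`-stable density `φ_α`, defined by Fourier inversion. -/
def stableDensity (α z : ℝ) : ℝ :=
  (2 * Real.pi)⁻¹ * ∫ u : ℝ, Real.cos (z * u) * Real.exp (-(|u| ^ α))

/-- `∂_α φ_α`. -/
def stableDensityDalpha (α z : ℝ) : ℝ :=
  -(2 * Real.pi)⁻¹ * ∫ u : ℝ, Real.cos (z * u) * |u| ^ α * Real.log |u| * Real.exp (-(|u| ^ α))

/-- The operator `(D f) y = (y * f y)' = f y + y * f' y`. -/
def Dop (f : ℝ → ℝ) (y : ℝ) : ℝ := f y + y * deriv f y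

/-- `f_α(y, w)`. -/
def fFun (α y w : ℝ) : ℝ := ∫ z : ℝ, gauss (y - w * z) * stableDensity α z

/-- `g_α(y, w)`. -/
def gFun (α y w : ℝ) : ℝ := ∫ z : ℝ, Dop gauss (y - w * z) * stableDensity α z

/-- `h_α(y, w)`. -/
def hFun (α y w : ℝ) : ℝ := ∫ z : ℝ, gauss (y - w * z) * Dop (stableDensity α) z

/-- `k_α(y, w)`. -/
def kFun (α y w : ℝ) : ℝ := ∫ z : ℝ, gauss (y - w * z) * stableDensityDalpha α z

/-- `c_α`. -/
def cAlpha (α : ℝ) : ℝ :=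
  if α = 1 then 1 / Real.pi
  else -(α * (α - 1)) / (2 * Real.Gamma (2 - α) * Real.cos (Real.pi * α / 2))

/-- `w_n(θ) = n^{1/2 - 1/α} δ / σ`. -/
def wn (n : ℕ) (σ δ α : ℝ) : ℝ := (n : ℝ) ^ ((1 : ℝ) / 2 - 1 / α) * δ / σ

/-- `l_α(y, w)` (it depends on `n`). -/
def lFun (n : ℕ) (α y w : ℝ) : ℝ :=
  ((Real.log n - Real.log (Real.log n)) / (2 * α) - Real.log n / α ^ 2) * hFun α y w
    + kFun α y w

def kappa0 (σ δ α : ℝ) : ℝ := 2 * cAlpha α / (α * (2 - α) ^ (α / 2)) * (δ / σ) ^ α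

def kappa1 (σ δ α : ℝ) : ℝ :=
  Real.log (δ / σ) + deriv cAlpha α / cAlpha α - Real.log (2 - α) / 2 - 1 / α

/-- The density `p_{1/n}(y, θ)`, with parameter `θ = (σ, δ, α) : Fin 3 → ℝ`. -/
def pdens (n : ℕ) (θ : Fin 3 → ℝ) (y : ℝ) : ℝ :=
  Real.sqrt n / θ 0 * fFun (θ 2) (Real.sqrt n * y / θ 0) (wn n (θ 0) (θ 1) (θ 2))

/-- The log-likelihood `ln L_n(θ)`. -/
def logLik (n : ℕ) (θ : Fin 3 → ℝ) (x : Fin n → ℝ) : ℝ :=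
  ∑ i, Real.log (pdens n θ (x i))

/-- Partial derivative in the `j`-th parameter coordinate. -/
def pderiv (j : Fin 3) (F : (Fin 3 → ℝ) → ℝ) (θ : Fin 3 → ℝ) : ℝ :=
  deriv (fun t => F (Function.update θ j t)) (θ j)

/-- The score `G_n(θ) = ∇_θ ln L_n(θ)`. -/
def scoreVec (n : ℕ) (θ : Fin 3 → ℝ) (x : Fin n → ℝ) : Fin 3 → ℝ :=
  fun j => pderiv j (fun θ' => logLik n θ' x) θ

/-- The Hessian matrix `J_n(θ)` of the log-likelihood. -/
def hessMat (n : ℕ) (θ : Fin 3 → ℝ) (x : Fin n → ℝ) : Matrix (Fin 3) (Fin 3) ℝ :=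
  Matrix.of fun i j => pderiv i (fun θ' => pderiv j (fun θ'' => logLik n θ'' x) θ') θ

def rate (n : ℕ) (α : ℝ) : ℝ := Real.log n ^ (α / 4) / (n : ℝ) ^ (α / 4)

/-- The rate matrix `u_n(θ)`. -/
def un (n : ℕ) (θ : Fin 3 → ℝ) : Matrix (Fin 3) (Fin 3) ℝ :=
  !![1 / Real.sqrt n, 0, 0;
     0, rate n (θ 2), -(rate n (θ 2) * (θ 1 / (2 * θ 2)) * (Real.log n - Real.log (Real.log n)));
     0, 0, rate n (θ 2)]

/-- The information matrix `I(θ)`. -/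
def Imat (θ : Fin 3 → ℝ) : Matrix (Fin 3) (Fin 3) ℝ :=
  !![2 / θ 0 ^ 2, 0, 0;
     0, θ 2 ^ 2 / θ 1 ^ 2 * kappa0 (θ 0) (θ 1) (θ 2),
        θ 2 / θ 1 * kappa0 (θ 0) (θ 1) (θ 2) * kappa1 (θ 0) (θ 1) (θ 2);
     0, θ 2 / θ 1 * kappa0 (θ 0) (θ 1) (θ 2) * kappa1 (θ 0) (θ 1) (θ 2),
        kappa0 (θ 0) (θ 1) (θ 2) * (kappa1 (θ 0) (θ 1) (θ 2) ^ 2 + 1 / θ 2 ^ 2)]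

/-- `ℙ_n`, the `n`-fold product of the law with Lebesgue density `p_{1/n}(·, θ)`. -/
def Pn (n : ℕ) (θ : Fin 3 → ℝ) : Measure (Fin n → ℝ) :=
  Measure.pi fun _ => MeasureTheory.volume.withDensity fun y => ENNReal.ofReal (pdens n θ y)

/-- The standard Gaussian measure on `ℝ³`. -/
def stdGauss3 : Measure (Fin 3 → ℝ) :=
  Measure.pi fun _ => ProbabilityTheory.gaussianReal 0 1

/-- Euclidean (Frobenius) norm of a real 3×3 matrix. -/
def frobNorm (M : Matrix (Fin 3) (Fin 3) ℝ) : ℝ := Real.sqrt (∑ i, ∑ j, M i j ^ 2)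

/-- Euclidean norm of a vector of `ℝ³`. -/
def vecNorm (v : Fin 3 → ℝ) : ℝ := Real.sqrt (∑ j, v j ^ 2)

/-- The admissible families of functions `ψ_α^{(p)}`. -/
structure IsPsiFamily (ψ : ℝ → ℕ → ℝ → ℝ) : Prop where
  contDiff : ∀ α ∈ Set.Ioo (0 : ℝ) 2, ∀ p : ℕ, ContDiff ℝ 2 (ψ α p)
  pos : ∀ α ∈ Set.Ioo (0 : ℝ) 2, ∀ p : ℕ, ∀ y : ℝ, 0 < ψ α p y
  even : ∀ α ∈ Set.Ioo (0 : ℝ) 2, ∀ p : ℕ, ∀ y : ℝ, ψ α p (-y) = ψ α p y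
  eq_one : ∀ α ∈ Set.Ioo (0 : ℝ) 2, ∀ p : ℕ, ∀ y : ℝ, |y| ≤ 1 → ψ α p y = 1
  eq_tail : ∀ α ∈ Set.Ioo (0 : ℝ) 2, ∀ p : ℕ, ∀ y : ℝ, 3 ≤ |y| →
    ψ α p y = Real.log |y| ^ p / |y| ^ (α + 1)
  unifBound : ∀ K : Set ℝ, K ⊆ Set.Ioo (0 : ℝ) 2 → IsCompact K → ∀ p : ℕ,
    ∃ c > (0 : ℝ), ∃ C : ℝ, ∀ α ∈ K, ∀ y : ℝ, 1 ≤ |y| → |y| ≤ 3 →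
      c ≤ ψ α p y ∧ ψ α p y ≤ C

/-- `𝓘_α^{(k,l)}`. -/
def Ical (ψ : ℝ → ℕ → ℝ → ℝ) (α : ℝ) (k l : ℕ) (y : ℝ) : ℝ :=
  ∫ z in {z : ℝ | 1 < |z|}, Dop^[k] gauss (y - z) * ψ α l z

/-- `f_α^{(k,l,m)}`. -/
def fklm (α : ℝ) (k l m : ℕ) (y w : ℝ) : ℝ :=
  ∫ z : ℝ, Dop^[k] gauss (y - w * z)
    * Dop^[l] (fun z' => iteratedDeriv m (fun a => stableDensity a z') α) z

def Gamman (n : ℕ) (α : ℝ) : ℝ := Real.sqrt ((1 - α / 2) * Real.log n)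

def Mn (n : ℕ) (α : ℝ) : ℝ := Real.sqrt ((2 - α) * Real.log n)

def Kconst (σ δ α : ℝ) : ℝ := deriv cAlpha α + cAlpha α * Real.log (δ / σ)
lemma Dop_iter_form (k : ℕ) : ∃ P : Polynomial ℝ, ∀ y, Dop^[k] gauss y = P.eval y * Real.exp (-(y ^ 2) / 2) := by
  induction k with
  | zero => exact ⟨Polynomial.C (Real.sqrt (2 * Real.pi))⁻¹, fun y => by simp [gauss]⟩
  | succ k ih =>
    obtain ⟨P, hP⟩ := ih
    refine ⟨P + Polynomial.X * (P.derivative - P * Polynomial.X), fun y => ?_⟩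
    rw [Function.iterate_succ_apply']
    have hf : Dop^[k] gauss = fun y => P.eval y * Real.exp (-(y ^ 2) / 2) := funext hP
    rw [hf]
    have h1 : HasDerivAt (fun y : ℝ => -(y ^ 2) / 2) (-y) y := by
      have := ((hasDerivAt_pow 2 y).neg).div_const 2
      exact this.congr_deriv (by push_cast; ring)
    have h2 := (P.hasDerivAt y).mul h1.exp
    have h3 : deriv (fun y => P.eval y * Real.exp (-(y ^ 2) / 2)) y = _ := h2.deriv
    simp only [Dop]
    rw [h3]
    simp
    ring

lemma poly_bound (P : Polynomial ℝ) : ∃ B ≥ (0:ℝ), ∃ n : ℕ, ∀ u : ℝ, |P.eval u| ≤ B * (1 + |u|) ^ n := by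
  induction P using Polynomial.induction_on' with
  | add p q hp hq =>
    obtain ⟨B, hB, n, h⟩ := hp
    obtain ⟨B', hB', n', h'⟩ := hq
    refine ⟨B + B', by positivity, n + n', fun u => ?_⟩
    have h1 : (1:ℝ) ≤ 1 + |u| := by linarith [abs_nonneg u]
    have e1 : (1 + |u|) ^ n ≤ (1 + |u|) ^ (n + n') := pow_le_pow_right₀ h1 (by omega)
    have e2 : (1 + |u|) ^ n' ≤ (1 + |u|) ^ (n + n') := pow_le_pow_right₀ h1 (by omega)
    rw [Polynomial.eval_add]
    calc _ ≤ |p.eval u| + |q.eval u| := abs_add_le _ _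
      _ ≤ B * (1 + |u|) ^ n + B' * (1 + |u|) ^ n' := add_le_add (h u) (h' u)
      _ ≤ B * (1 + |u|) ^ (n + n') + B' * (1 + |u|) ^ (n + n') := by gcongr
      _ = _ := by ring
  | monomial n a =>
    refine ⟨|a|, abs_nonneg _, n, fun u => ?_⟩
    rw [Polynomial.eval_monomial, abs_mul, abs_pow]
    gcongr
    linarith

lemma Dop_decay (k M : ℕ) : ∃ A > (0:ℝ), ∀ u : ℝ,
    |Dop^[k] gauss u| * (1 + |u|) ^ M ≤ A * (1 + u ^ 2)⁻¹ := by
  obtain ⟨P, hP⟩ := Dop_iter_form k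
  obtain ⟨B, hB, n, h⟩ := poly_bound P
  set N := n + M + 2 with hN
  refine ⟨B * (N.factorial * Real.exp (3/2)) + 1, by positivity, fun u => ?_⟩
  have hu := abs_nonneg u
  have h0 : (1 + |u|) ^ N ≤ N.factorial * Real.exp (3/2) * Real.exp (u ^ 2 / 2) := by
    have := Real.pow_div_factorial_le_exp (1 + |u|) (by positivity) N
    rw [div_le_iff₀ (by positivity)] at this
    have h2 : Real.exp (1 + |u|) ≤ Real.exp (3/2) * Real.exp (u ^ 2 / 2) := by
      rw [← Real.exp_add]
      apply Real.exp_le_exp.2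
      nlinarith [sq_nonneg (|u| - 1), sq_abs u]
    have h3 : (0:ℝ) ≤ N.factorial := by positivity
    nlinarith
  have h1 : 1 + u ^ 2 ≤ (1 + |u|) ^ 2 := by nlinarith [sq_abs u]
  have he : Real.exp (u ^ 2 / 2) * Real.exp (-(u ^ 2) / 2) = 1 := by
    rw [← Real.exp_add]; simp; ring
  rw [← div_eq_mul_inv, le_div_iff₀ (by positivity), hP, abs_mul, abs_of_pos (Real.exp_pos _)]
  calc _ ≤ B * (1 + |u|) ^ n * Real.exp (-(u ^ 2) / 2) * (1 + |u|) ^ M * (1 + |u|) ^ 2 := by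
        gcongr
        exact h u
    _ = B * (1 + |u|) ^ N * Real.exp (-(u ^ 2) / 2) := by rw [hN]; ring
    _ ≤ B * (N.factorial * Real.exp (3/2) * Real.exp (u ^ 2 / 2)) * Real.exp (-(u ^ 2) / 2) := by gcongr
    _ = B * (N.factorial * Real.exp (3/2)) * (Real.exp (u ^ 2 / 2) * Real.exp (-(u ^ 2) / 2)) := by ring
    _ ≤ _ := by rw [he]; linarith

lemma Dop_cont (k : ℕ) : Continuous (Dop^[k] gauss) := by
  obtain ⟨P, hP⟩ := Dop_iter_form k
  rw [funext hP]
  have := P.continuous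
  fun_prop

/-- The model weight comparable with `ψ α p`. -/
def mW (α : ℝ) (p : ℕ) (y : ℝ) : ℝ := (1 + Real.log (1 + |y|)) ^ p / (1 + |y|) ^ (α + 1)

lemma log_nn (y : ℝ) : 0 ≤ Real.log (1 + |y|) := Real.log_nonneg (by linarith [abs_nonneg y])

lemma log_le_abs (y : ℝ) : Real.log (1 + |y|) ≤ |y| := by
  have := Real.log_le_sub_one_of_pos (x := 1 + |y|) (by positivity)
  linarith

lemma mW_pos (α : ℝ) (p : ℕ) (y : ℝ) : 0 < mW α p y := by
  have := log_nn y
  unfold mW; positivity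

lemma mW_moderate (α : ℝ) (hα : α ∈ Set.Ioo (0 : ℝ) 2) (p : ℕ) (y z : ℝ) :
    mW α p z ≤ mW α p y * (1 + |y - z|) ^ (p + 3) := by
  unfold mW
  have hy := abs_nonneg y
  have hz := abs_nonneg z
  have hu := abs_nonneg (y - z)
  have ly := log_nn y
  have lz := log_nn z
  have lu := log_nn (y - z)
  have lu' := log_le_abs (y - z)
  have t1 : 1 + |y| ≤ (1 + |z|) * (1 + |y - z|) := by
    have : |y| ≤ |z| + |y - z| := by
      have := abs_add_le z (y - z); simpa using this
    nlinarith
  have t2 : 1 + |z| ≤ (1 + |y|) * (1 + |y - z|) := by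
    have : |z| ≤ |y| + |y - z| := by
      have := abs_add_le y (z - y); rw [abs_sub_comm z y] at this; simpa using this
    nlinarith
  have t3 : 1 + Real.log (1 + |z|) ≤ (1 + Real.log (1 + |y|)) * (1 + |y - z|) := by
    have := Real.log_le_log (by positivity) t2
    rw [Real.log_mul (by positivity) (by positivity)] at this
    nlinarith
  have t4 : (1 + |y|) ^ (α + 1) ≤ (1 + |z|) ^ (α + 1) * (1 + |y - z|) ^ 3 := by
    calc _ ≤ ((1 + |z|) * (1 + |y - z|)) ^ (α + 1) :=
          Real.rpow_le_rpow (by positivity) t1 (by linarith [hα.1])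
      _ = (1 + |z|) ^ (α + 1) * (1 + |y - z|) ^ (α + 1) :=
          Real.mul_rpow (by positivity) (by positivity)
      _ ≤ (1 + |z|) ^ (α + 1) * (1 + |y - z|) ^ (3:ℝ) := by
          gcongr
          · linarith
          · linarith [hα.2]
      _ = _ := by norm_cast
  rw [div_mul_eq_mul_div, div_le_div_iff₀ (by positivity) (by positivity)]
  calc _ ≤ ((1 + Real.log (1 + |y|)) * (1 + |y - z|)) ^ p * ((1 + |z|) ^ (α + 1) * (1 + |y - z|) ^ 3) := by
        gcongr
    _ = _ := by rw [mul_pow]; ring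

lemma psi_compare (K : Set ℝ) (hK : IsCompact K) (hKsub : K ⊆ Set.Ioo (0 : ℝ) 2)
    (ψ : ℝ → ℕ → ℝ → ℝ) (hψ : IsPsiFamily ψ) (p : ℕ) :
    ∃ A > (0:ℝ), ∀ α ∈ K, ∀ y, ψ α p y ≤ A * mW α p y ∧ mW α p y ≤ A * ψ α p y := by
  obtain ⟨c, hc, C, h⟩ := hψ.unifBound K hKsub hK p
  refine ⟨64 * (1 + |C|) + 4 ^ p * (1 + c⁻¹), by positivity, fun α hα y => ?_⟩
  have hα' := hKsub hα
  have hy := abs_nonneg y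
  have ly := log_nn y
  have ly' := log_le_abs y
  have hm := mW_pos α p y
  have hp := hψ.pos α hα' p y
  have hC := abs_nonneg C
  have hci : 0 < c⁻¹ := by positivity
  have h4 : (1:ℝ) ≤ 4 ^ p := one_le_pow₀ (by norm_num)
  set A := 64 * (1 + |C|) + 4 ^ p * (1 + c⁻¹) with hA
  have hA1 : 64 * (1 + |C|) ≤ A := by rw [hA]; have : 0 < 4 ^ p * (1 + c⁻¹) := by positivity
                                      linarith
  have hA2 : 4 ^ p * (1 + c⁻¹) ≤ A := by rw [hA]; linarith
  have hA3 : 64 ≤ A := by linarith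
  have hA4 : 4 ^ p ≤ A := by nlinarith
  have small : |y| ≤ 3 → 1 ≤ 64 * mW α p y ∧ mW α p y ≤ 4 ^ p := by
    intro h3
    unfold mW
    have d1 : (1 + |y|) ^ (α + 1) ≤ 64 := by
      calc (1 + |y|) ^ (α + 1) ≤ (1 + |y|) ^ (3:ℝ) := by
            gcongr
            · linarith
            · linarith [hα'.2]
        _ = (1 + |y|) ^ 3 := by norm_cast
        _ ≤ 4 ^ 3 := by gcongr; linarith
        _ = 64 := by norm_num
    have d2 : 1 ≤ (1 + |y|) ^ (α + 1) := Real.one_le_rpow (by linarith) (by linarith [hα'.1])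
    have n1 : 1 ≤ (1 + Real.log (1 + |y|)) ^ p := one_le_pow₀ (by linarith)
    have n2 : (1 + Real.log (1 + |y|)) ^ p ≤ 4 ^ p := by gcongr; linarith
    constructor
    · rw [← mul_div_assoc, le_div_iff₀ (by positivity)]; linarith
    · rw [div_le_iff₀ (by positivity)]; nlinarith
  rcases le_or_gt |y| 1 with h1 | h1
  · rw [hψ.eq_one α hα' p y h1]
    obtain ⟨s1, s2⟩ := small (by linarith)
    constructor
    · nlinarith
    · linarith
  rcases le_or_gt |y| 3 with h3 | h3
  · obtain ⟨s1, s2⟩ := small h3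
    obtain ⟨b1, b2⟩ := h α hα y h1.le h3
    constructor
    · have := le_abs_self C
      nlinarith
    · have : 1 ≤ c⁻¹ * ψ α p y := by
        rw [inv_mul_eq_div, le_div_iff₀ hc]; linarith
      calc _ ≤ (4:ℝ) ^ p * 1 := by linarith
        _ ≤ 4 ^ p * (c⁻¹ * ψ α p y) := by gcongr
        _ ≤ 4 ^ p * (1 + c⁻¹) * ψ α p y := by nlinarith [mul_pos (lt_of_lt_of_le one_pos h4) hp]
        _ ≤ _ := by gcongr
  · rw [hψ.eq_tail α hα' p y h3.le]
    unfold mW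
    have l1 : 1 ≤ Real.log |y| := by
      rw [Real.le_log_iff_exp_le (by linarith)]
      linarith [Real.exp_one_lt_d9]
    have l2 : Real.log |y| ≤ 1 + Real.log (1 + |y|) := by
      have := Real.log_le_log (by linarith) (show |y| ≤ 1 + |y| by linarith)
      linarith
    have l3 : 1 + Real.log (1 + |y|) ≤ 4 * Real.log |y| := by
      have := Real.log_le_log (by linarith) (show 1 + |y| ≤ |y| * |y| by nlinarith)
      rw [Real.log_mul (by linarith) (by linarith)] at this
      linarith
    have hyp : 0 < |y| := by linarith
    have d1 : |y| ^ (α + 1) ≤ (1 + |y|) ^ (α + 1) :=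
      Real.rpow_le_rpow (by linarith) (by linarith) (by linarith [hα'.1])
    have d2 : (1 + |y|) ^ (α + 1) ≤ 64 * |y| ^ (α + 1) := by
      calc (1 + |y|) ^ (α + 1) ≤ (4 * |y|) ^ (α + 1) :=
            Real.rpow_le_rpow (by linarith) (by linarith) (by linarith [hα'.1])
        _ = 4 ^ (α + 1) * |y| ^ (α + 1) := Real.mul_rpow (by norm_num) (by linarith)
        _ ≤ 4 ^ (3:ℝ) * |y| ^ (α + 1) := by
            gcongr
            · norm_num
            · linarith [hα'.2]
        _ = _ := by norm_num
    have l0 : 0 ≤ Real.log |y| := by linarith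
    constructor
    · rw [← mul_div_assoc, div_le_div_iff₀ (by positivity) (by positivity)]
      calc _ ≤ (1 + Real.log (1 + |y|)) ^ p * (64 * |y| ^ (α + 1)) := by gcongr
        _ = 64 * (1 + Real.log (1 + |y|)) ^ p * |y| ^ (α + 1) := by ring
        _ ≤ _ := by gcongr
    · rw [← mul_div_assoc, div_le_div_iff₀ (by positivity) (by positivity)]
      calc _ ≤ (4 * Real.log |y|) ^ p * (1 + |y|) ^ (α + 1) := by gcongr
        _ = 4 ^ p * Real.log |y| ^ p * (1 + |y|) ^ (α + 1) := by rw [mul_pow]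
        _ ≤ _ := by gcongr

lemma psi_moderate (K : Set ℝ) (hK : IsCompact K) (hKsub : K ⊆ Set.Ioo (0 : ℝ) 2)
    (ψ : ℝ → ℕ → ℝ → ℝ) (hψ : IsPsiFamily ψ) (p : ℕ) :
    ∃ A > (0:ℝ), ∀ α ∈ K, ∀ y z, ψ α p z ≤ A * ψ α p y * (1 + |y - z|) ^ (p + 3) := by
  obtain ⟨A, hA, h⟩ := psi_compare K hK hKsub ψ hψ p
  refine ⟨A * A, by positivity, fun α hα y z => ?_⟩
  calc ψ α p z ≤ A * mW α p z := (h α hα z).1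
    _ ≤ A * (mW α p y * (1 + |y - z|) ^ (p + 3)) := by
        gcongr; exact mW_moderate α (hKsub hα) p y z
    _ ≤ A * ((A * ψ α p y) * (1 + |y - z|) ^ (p + 3)) := by
        gcongr; exact (h α hα y).2
    _ = _ := by ring

lemma upper (k p : ℕ) (K : Set ℝ) (hK : IsCompact K) (hKsub : K ⊆ Set.Ioo (0 : ℝ) 2)
    (ψ : ℝ → ℕ → ℝ → ℝ) (hψ : IsPsiFamily ψ) :
    ∃ C > (0:ℝ), ∀ α ∈ K, ∀ y,
      Integrable (fun z => Dop^[k] gauss (y - z) * ψ α p z) ∧ |Ical ψ α k p y| ≤ C * ψ α p y := by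
  obtain ⟨A, hA, h⟩ := psi_moderate K hK hKsub ψ hψ p
  obtain ⟨B, hB, hd⟩ := Dop_decay k (p + 3)
  refine ⟨A * B * Real.pi, by positivity, fun α hα y => ?_⟩
  have hα' := hKsub hα
  have hpy := hψ.pos α hα' p y
  have key : ∀ z, ‖Dop^[k] gauss (y - z) * ψ α p z‖ ≤ A * B * ψ α p y * (1 + (y - z) ^ 2)⁻¹ := by
    intro z
    rw [Real.norm_eq_abs, abs_mul, abs_of_pos (hψ.pos α hα' p z)]
    calc _ ≤ |Dop^[k] gauss (y - z)| * (A * ψ α p y * (1 + |y - z|) ^ (p + 3)) := by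
          gcongr; exact h α hα y z
      _ = A * ψ α p y * (|Dop^[k] gauss (y - z)| * (1 + |y - z|) ^ (p + 3)) := by ring
      _ ≤ A * ψ α p y * (B * (1 + (y - z) ^ 2)⁻¹) :=
          mul_le_mul_of_nonneg_left (hd _) (by positivity)
      _ = _ := by ring
  have hi : Integrable (fun z => A * B * ψ α p y * (1 + (y - z) ^ 2)⁻¹) :=
    (integrable_inv_one_add_sq.comp_sub_left y).const_mul _
  have hcont : Continuous (fun z => Dop^[k] gauss (y - z) * ψ α p z) := by
    have h1 := Dop_cont k
    have h2 := (hψ.contDiff α hα' p).continuous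
    fun_prop
  refine ⟨hi.mono' hcont.aestronglyMeasurable (ae_of_all _ key), ?_⟩
  unfold Ical
  rw [← Real.norm_eq_abs]
  calc _ ≤ ∫ z in {z : ℝ | 1 < |z|}, A * B * ψ α p y * (1 + (y - z) ^ 2)⁻¹ :=
        norm_integral_le_of_norm_le hi.integrableOn (ae_of_all _ key)
    _ ≤ ∫ z, A * B * ψ α p y * (1 + (y - z) ^ 2)⁻¹ :=
        setIntegral_le_integral hi (ae_of_all _ fun z => by
          show 0 ≤ A * B * ψ α p y * (1 + (y - z) ^ 2)⁻¹
          positivity)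
    _ = A * B * ψ α p y * Real.pi := by
        rw [integral_const_mul, integral_sub_left_eq_self (fun x : ℝ => (1 + x ^ 2)⁻¹) volume y,
          integral_univ_inv_one_add_sq]
    _ = _ := by ring

lemma lower (K : Set ℝ) (hK : IsCompact K) (hKsub : K ⊆ Set.Ioo (0 : ℝ) 2)
    (ψ : ℝ → ℕ → ℝ → ℝ) (hψ : IsPsiFamily ψ) :
    ∃ c > (0:ℝ), ∀ α ∈ K, ∀ y, c * ψ α 0 y ≤ Ical ψ α 0 0 y := by
  obtain ⟨A, hA, h⟩ := psi_moderate K hK hKsub ψ hψ 0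
  obtain ⟨_, _, hupp⟩ := upper 0 0 K hK hKsub ψ hψ
  have g2 : 0 < gauss 2 := by unfold gauss; positivity
  have gnn : ∀ u, 0 ≤ gauss u := fun u => by unfold gauss; positivity
  refine ⟨gauss 2 * (A * 27)⁻¹, by positivity, fun α hα y => ?_⟩
  have hα' := hKsub hα
  have hpy := hψ.pos α hα' 0 y
  obtain ⟨a, ha1, ha2⟩ : ∃ a : ℝ, Ioo a (a + 1) ⊆ {z : ℝ | 1 < |z|} ∧
      ∀ z ∈ Ioo a (a + 1), |y - z| ≤ 2 := by
    rcases le_or_gt 0 y with hy | hy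
    · refine ⟨y + 1, fun z hz => ?_, fun z hz => ?_⟩
      · have := hz.1
        show 1 < |z|
        exact lt_abs.2 (Or.inl (by linarith))
      · have := hz.1
        have := hz.2
        exact abs_le.2 ⟨by linarith, by linarith⟩
    · refine ⟨y - 2, fun z hz => ?_, fun z hz => ?_⟩
      · have := hz.2
        show 1 < |z|
        exact lt_abs.2 (Or.inr (by linarith))
      · have := hz.1
        have := hz.2
        exact abs_le.2 ⟨by linarith, by linarith⟩
  have hI := (hupp α hα y).1
  unfold Ical
  calc gauss 2 * (A * 27)⁻¹ * ψ α 0 y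
      = ∫ z in Ioo a (a + 1), gauss 2 * (A * 27)⁻¹ * ψ α 0 y := by
        simp
    _ ≤ ∫ z in Ioo a (a + 1), Dop^[0] gauss (y - z) * ψ α 0 z := by
        apply setIntegral_mono_on (integrableOn_const (by simp)) hI.integrableOn measurableSet_Ioo
        intro z hz
        have hz2 := ha2 z hz
        have e1 : gauss 2 ≤ gauss (y - z) := by
          unfold gauss
          have : (y - z) ^ 2 ≤ 2 ^ 2 := sq_le_sq' (by linarith [(abs_le.1 hz2).1]) (abs_le.1 hz2).2
          gcongr
        have e2 : (A * 27)⁻¹ * ψ α 0 y ≤ ψ α 0 z := by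
          rw [inv_mul_le_iff₀ (by positivity)]
          have hz' := hψ.pos α hα' 0 z
          calc _ ≤ A * ψ α 0 z * (1 + |z - y|) ^ (0 + 3) := h α hα z y
            _ ≤ A * ψ α 0 z * (1 + 2) ^ (0 + 3) := by
                rw [abs_sub_comm z y]; gcongr
            _ = _ := by ring
        simp only [Function.iterate_zero, id]
        rw [mul_assoc]
        exact mul_le_mul e1 e2 (by positivity) (gnn _)
    _ ≤ _ := by
        apply setIntegral_mono_set hI.integrableOn
        · exact ae_of_all _ fun z => mul_nonneg (gnn _) (hψ.pos α hα' 0 z).le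
        · exact LE.le.eventuallyLE ha1

/-- uniform bounds for `𝓘_α^{(k,l)}` and two-sided bounds for `𝓘_α^{(0,0)}`. -/
theorem statement6 (k l : ℕ) (K : Set ℝ) (hK : IsCompact K) (hKsub : K ⊆ Set.Ioo (0 : ℝ) 2)
    (ψ : ℝ → ℕ → ℝ → ℝ) (hψ : IsPsiFamily ψ) :
    ∃ C > (0 : ℝ), ∀ α ∈ K, ∀ y : ℝ,
      |Ical ψ α k l y| ≤ C * ψ α l y ∧
      1 / C * ψ α 0 y ≤ Ical ψ α 0 0 y ∧
      Ical ψ α 0 0 y ≤ C * ψ α 0 y := by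
  obtain ⟨C₁, h₁, H₁⟩ := upper k l K hK hKsub ψ hψ
  obtain ⟨C₂, h₂, H₂⟩ := upper 0 0 K hK hKsub ψ hψ
  obtain ⟨c, hc, H₃⟩ := lower K hK hKsub ψ hψ
  have hci : 0 < c⁻¹ := by positivity
  refine ⟨C₁ + C₂ + c⁻¹, by positivity, fun α hα y => ⟨?_, ?_, ?_⟩⟩
  · have := hψ.pos α (hKsub hα) l y
    refine (H₁ α hα y).2.trans ?_
    gcongr
    linarith
  · have := hψ.pos α (hKsub hα) 0 y
    refine le_trans ?_ (H₃ α hα y)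
    gcongr
    rw [one_div]
    exact inv_le_of_inv_le₀ hc (by linarith)
  · have := hψ.pos α (hKsub hα) 0 y
    refine (le_abs_self _).trans ((H₂ α hα y).2.trans ?_)
    gcongr
    linarith

end LevyLAN
end
end

section
/- Let K be a compact subset of (0,2). There exists C > 0 such that for all α ∈ K, all w ∈ (0, 1/3] and all y ∈ ℝ: (i) |f_α(y,w) − φ(y) − c_α w^α 𝓘_α^{(0,0)}(y)| ≤ C(w^α φ(y/2) + w^{2α} ψ_α^{(0)}(y)); (ii) |g_α(y,w) − D(φ)(y)| ≤ C w^α ψ_α^{(0)}(y); (iii) |h_α(y,w) + α c_α w^α 𝓘_α^{(0,0)}(y)| ≤ C(w^α φ(y/2) + w^{2α} ψ_α^{(0)}(y)); (iv) |k_α(y,w) + c_α w^α ln(1/w) 𝓘_α^{(0,0)}(y) + c_α w^α 𝓘_α^{(0,1)}(y) − (∂_α c_α) w^α 𝓘_α^{(0,0)}(y)| ≤ C w^α [ ln(1/w)(φ(y/2) + w^α ψ_α^{(0)}(y)) + w^α ψ_α^{(1)}(y) ]. -/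
open MeasureTheory Filter Set Topology Matrix

noncomputable section

namespace LevyLAN

lemma gauss_eq_pdf : gauss = ProbabilityTheory.gaussianPDFReal 0 1 := by
  funext x
  simp [gauss, ProbabilityTheory.gaussianPDFReal]

lemma gauss_cont : Continuous gauss := by
  unfold gauss; fun_prop

lemma gauss_integrable : Integrable gauss := by
  rw [gauss_eq_pdf]; exact ProbabilityTheory.integrable_gaussianPDFReal 0 1

lemma gauss_even (x : ℝ) : gauss (-x) = gauss x := by simp [gauss]

lemma gauss_pos (x : ℝ) : 0 < gauss x := by unfold gauss; positivity

lemma gauss_hasDeriv (x : ℝ) : HasDerivAt gauss (-x * gauss x) x := by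
  unfold gauss
  have h : HasDerivAt (fun x : ℝ => -(x ^ 2) / 2) (-x) x := by
    have := ((hasDerivAt_pow 2 x).neg.div_const 2)
    exact this.congr_deriv (by simp; ring)
  have := (h.exp).const_mul ((Real.sqrt (2 * Real.pi))⁻¹)
  exact this.congr_deriv (by ring)

lemma pow_gauss_integrable (n : ℕ) : Integrable (fun x => x ^ n * gauss x) := by
  have h := integrable_rpow_mul_exp_neg_mul_sq (b := 1/2) (by norm_num) (s := (n:ℝ))
    (by have : (0:ℝ) ≤ n := Nat.cast_nonneg n
        linarith)
  have := h.const_mul ((Real.sqrt (2 * Real.pi))⁻¹)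
  refine this.congr (Eventually.of_forall fun x => ?_)
  simp only [gauss, Real.rpow_natCast]
  rw [show -(1/2) * x ^ 2 = -(x^2)/2 by ring]; ring

lemma gauss_cos (t : ℝ) : ∫ x, Real.cos (t * x) * gauss x = Real.exp (-(t ^ 2) / 2) := by
  have h := ProbabilityTheory.charFun_gaussianReal (μ := 0) (v := 1) t
  rw [charFun_apply_real, ProbabilityTheory.integral_gaussianReal_eq_integral_smul (by norm_num)] at h
  have h2 := congrArg Complex.re h
  rw [← gauss_eq_pdf] at h2
  have hintg : Integrable (fun x : ℝ => gauss x • Complex.exp (t * x * Complex.I)) := by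
    refine (gauss_integrable.norm).mono' ?_ ?_
    · exact (gauss_cont.smul (by fun_prop)).aestronglyMeasurable
    · refine Eventually.of_forall fun x => ?_
      rw [norm_smul, show (t:ℂ) * x * Complex.I = ((t * x : ℝ) : ℂ) * Complex.I by push_cast; ring,
        Complex.norm_exp_ofReal_mul_I, mul_one]
  have h3 : ∫ x, (gauss x • Complex.exp (t * x * Complex.I)).re
      = (∫ x, gauss x • Complex.exp (t * x * Complex.I)).re := integral_re hintg
  rw [← h3] at h2
  have e1 : ∀ x : ℝ, (gauss x • Complex.exp (t * x * Complex.I)).re = Real.cos (t * x) * gauss x := by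
    intro x
    rw [show (t:ℂ) * x * Complex.I = ((t * x : ℝ) : ℂ) * Complex.I by push_cast; ring]
    rw [Complex.smul_re, Complex.exp_ofReal_mul_I_re]
    simp [mul_comm]
  have e2 : (Complex.exp (t * (0:ℝ) * Complex.I - ((1:NNReal):ℝ) * t ^ 2 / 2)).re = Real.exp (-(t ^ 2) / 2) := by
    rw [show (t * (0:ℝ) * Complex.I - ((1:NNReal):ℝ) * t ^ 2 / 2 : ℂ) = ((-(t^2)/2 : ℝ) : ℂ) by
      push_cast; ring]
    exact Complex.exp_ofReal_re _
  calc _ = _ := by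
        refine integral_congr_ae (Eventually.of_forall fun x => ?_)
        exact (e1 x).symm
    _ = _ := h2
    _ = _ := e2

/-- the kernel `D φ` -/
lemma Dop_gauss (x : ℝ) : Dop gauss x = (1 - x ^ 2) * gauss x := by
  rw [Dop, (gauss_hasDeriv x).deriv]; ring

lemma Dgauss_cont : Continuous (Dop gauss) := by
  have : Dop gauss = fun x => (1 - x^2) * gauss x := funext Dop_gauss
  rw [this]; have := gauss_cont; fun_prop

lemma Dgauss_integrable : Integrable (Dop gauss) := by
  have : Dop gauss = fun x => gauss x - x^2 * gauss x := by
    funext x; rw [Dop_gauss]; ring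
  rw [this]; exact gauss_integrable.sub (pow_gauss_integrable 2)

lemma Dgauss_even (x : ℝ) : Dop gauss (-x) = Dop gauss x := by
  rw [Dop_gauss, Dop_gauss, gauss_even]; ring

lemma cos_mul_integrable {κ : ℝ → ℝ} (hc : Continuous κ) (hi : Integrable κ) (t s : ℝ) :
    Integrable (fun x => Real.cos (t * x + s) * κ x) := by
  refine hi.norm.mono' (by fun_prop) (Eventually.of_forall fun x => ?_)
  rw [norm_mul]
  calc _ ≤ 1 * ‖κ x‖ := by gcongr; exact Real.abs_cos_le_one _
    _ = _ := one_mul _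

lemma sin_mul_integrable {κ : ℝ → ℝ} (hc : Continuous κ) (hi : Integrable κ) (t : ℝ) :
    Integrable (fun x => Real.sin (t * x) * κ x) := by
  have := cos_mul_integrable hc hi t (-(Real.pi/2))
  simpa [← sub_eq_add_neg, Real.cos_sub_pi_div_two] using this

lemma Dgauss_cos (t : ℝ) :
    ∫ x, Real.cos (t * x) * Dop gauss x = t ^ 2 * Real.exp (-(t ^ 2) / 2) := by
  have key : ∀ x, HasDerivAt (fun x => Real.cos (t * x) * (x * gauss x) - t * (Real.sin (t * x) * gauss x))
      (Real.cos (t * x) * Dop gauss x - t ^ 2 * (Real.cos (t * x) * gauss x)) x := by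
    intro x
    have hl : HasDerivAt (fun x : ℝ => t * x) t x := by simpa using (hasDerivAt_id x).const_mul t
    have h1 := (hl.cos).mul ((hasDerivAt_id x).mul (gauss_hasDeriv x))
    have h2 := ((hl.sin).mul (gauss_hasDeriv x)).const_mul t
    have := h1.sub h2
    refine this.congr_deriv ?_
    rw [Dop_gauss]; simp; ring
  have c1 := cos_mul_integrable Dgauss_cont Dgauss_integrable t 0
  have c2 := cos_mul_integrable gauss_cont gauss_integrable t 0
  have c3 := cos_mul_integrable (κ := fun x => x * gauss x) (continuous_id.mul gauss_cont)
    (by simpa using pow_gauss_integrable 1) t 0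
  have c4 := sin_mul_integrable gauss_cont gauss_integrable t
  simp only [add_zero] at c1 c2 c3
  have h0 := integral_eq_zero_of_hasDerivAt_of_integrable key (c1.sub (c2.const_mul _))
    (c3.sub (c4.const_mul _))
  rw [integral_sub c1 (c2.const_mul _), integral_const_mul, gauss_cos] at h0
  linarith

lemma sin_even_zero {κ : ℝ → ℝ} (he : ∀ x, κ (-x) = κ x) (t : ℝ) :
    ∫ x, Real.sin (t * x) * κ x = 0 := by
  have h := integral_neg_eq_self (fun x => Real.sin (t * x) * κ x) volume
  have h2 : ∫ x, Real.sin (t * -x) * κ (-x) = - ∫ x, Real.sin (t * x) * κ x := by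
    rw [← integral_neg]
    refine integral_congr_ae (Eventually.of_forall fun x => ?_)
    simp [he]
  linarith [h2.symm.trans h]

lemma inner_conv {κ κh : ℝ → ℝ} (hc : Continuous κ) (hi : Integrable κ) (he : ∀ x, κ (-x) = κ x)
    (hcos : ∀ t, ∫ x, Real.cos (t * x) * κ x = κh t) {w : ℝ} (hw : 0 < w) (y u : ℝ) :
    ∫ z, κ (y - w * z) * Real.cos (z * u) = w⁻¹ * (Real.cos (y * (u / w)) * κh (u / w)) := by
  have h1 : ∫ z, κ (y - w * z) * Real.cos (z * u)
      = ∫ z, (fun x => κ (y - x) * Real.cos (x * (u / w))) (w * z) := by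
    refine integral_congr_ae (Eventually.of_forall fun z => ?_)
    simp only
    congr 2; field_simp
  rw [h1, Measure.integral_comp_mul_left (fun x => κ (y - x) * Real.cos (x * (u / w)))]
  have h2 : ∫ x, κ (y - x) * Real.cos (x * (u / w))
      = ∫ x, (fun x => κ x * Real.cos ((y - x) * (u / w))) (y - x) := by
    refine integral_congr_ae (Eventually.of_forall fun z => ?_)
    simp
  rw [h2, integral_sub_left_eq_self (fun x => κ x * Real.cos ((y - x) * (u / w)))]
  have h3 : ∫ x, κ x * Real.cos ((y - x) * (u / w))
      = ∫ x, (Real.cos (y * (u/w)) * (Real.cos ((u/w) * x) * κ x)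
        + Real.sin (y * (u/w)) * (Real.sin ((u/w) * x) * κ x)) := by
    refine integral_congr_ae (Eventually.of_forall fun x => ?_)
    simp only
    rw [show (y - x) * (u/w) = y * (u/w) - (u/w) * x by ring, Real.cos_sub]; ring
  have c2 := cos_mul_integrable hc hi (u/w) 0
  simp only [add_zero] at c2
  rw [h3, integral_add (c2.const_mul _) ((sin_mul_integrable hc hi (u/w)).const_mul _),
    integral_const_mul, integral_const_mul, sin_even_zero he, hcos, abs_of_pos (inv_pos.mpr hw)]
  simp

lemma conv_symbol {κ κh : ℝ → ℝ} (hc : Continuous κ) (hi : Integrable κ) (he : ∀ x, κ (-x) = κ x)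
    (hcos : ∀ t, ∫ x, Real.cos (t * x) * κ x = κh t) {S : ℝ → ℝ} (hS : IntegrableOn S (Ioi 0))
    {w : ℝ} (hw : 0 < w) (y : ℝ) :
    ∫ z, κ (y - w * z) * (∫ u in Ioi 0, Real.cos (z * u) * S u)
      = ∫ u in Ioi 0, Real.cos (y * u) * κh u * S (w * u) := by
  have h1 : ∫ z, κ (y - w * z) * (∫ u in Ioi 0, Real.cos (z * u) * S u)
      = ∫ z, ∫ u in Ioi 0, κ (y - w * z) * (Real.cos (z * u) * S u) := by
    simp_rw [integral_const_mul]
  have hκ : Integrable (fun z => κ (y - w * z)) :=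
    ((integrable_comp_mul_left_iff (fun x => κ (y - x)) hw.ne').2 (hi.comp_sub_left y))
  have hprod : Integrable (Function.uncurry fun z u => κ (y - w * z) * (Real.cos (z * u) * S u))
      ((volume : Measure ℝ).prod (volume.restrict (Ioi 0))) := by
    have hp := (hκ.mul_prod hS)
    refine hp.norm.mono' ?_ (Eventually.of_forall fun p => ?_)
    · have : (Function.uncurry fun z u => κ (y - w * z) * (Real.cos (z * u) * S u))
        = fun p : ℝ × ℝ => Real.cos (p.1 * p.2) * (κ (y - w * p.1) * S p.2) := by
        funext p; simp [Function.uncurry]; ring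
      rw [this]
      exact (Continuous.aestronglyMeasurable (by fun_prop)).mul hp.aestronglyMeasurable
    · simp only [Function.uncurry, norm_mul]
      have : ‖Real.cos (p.1 * p.2)‖ ≤ 1 := Real.abs_cos_le_one _
      have h0 : 0 ≤ ‖S p.2‖ := norm_nonneg _
      gcongr
      nlinarith
  rw [h1, integral_integral_swap hprod]
  have h2 : ∀ u, ∫ z, κ (y - w * z) * (Real.cos (z * u) * S u)
      = w⁻¹ * ((fun v => Real.cos (y * v) * κh v * S (w * v)) (w⁻¹ * u)) := by
    intro u
    simp_rw [← mul_assoc]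
    rw [integral_mul_const, inner_conv hc hi he hcos hw]
    rw [show u / w = w⁻¹ * u by rw [div_eq_inv_mul]]
    simp only [mul_assoc]
    rw [mul_inv_cancel_left₀ hw.ne']
  simp_rw [h2]
  rw [integral_const_mul, integral_comp_mul_left_Ioi
    (fun v => Real.cos (y * v) * κh v * S (w * v)) _ (inv_pos.mpr hw)]
  simp [hw.ne']



lemma rpow_exp_integrable {p q : ℝ} (hp : 0 < p) (hq : -1 < q) :
    IntegrableOn (fun u : ℝ => u ^ q * Real.exp (-(u ^ p))) (Ioi 0) := by
  by_contra h
  have h1 := integral_undef h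
  rw [integral_rpow_mul_exp_neg_rpow hp hq] at h1
  have : 0 < Real.Gamma ((q + 1) / p) := Real.Gamma_pos_of_pos (by apply div_pos <;> linarith)
  have : 0 < 1 / p * Real.Gamma ((q + 1) / p) := by positivity
  linarith

lemma exp_integrable {p : ℝ} (hp : 0 < p) :
    IntegrableOn (fun u : ℝ => Real.exp (-(u ^ p))) (Ioi 0) := by
  simpa using rpow_exp_integrable hp (q := 0) (by norm_num)

lemma rpow_log_bound {a α u : ℝ} (ha : 0 < a) (haα : a ≤ α) (hu : 0 < u) :
    u ^ α * |Real.log u| ≤ 1 / a + u ^ α * u := by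
  rcases le_total u 1 with h | h
  · have h1 := (Real.abs_log_mul_self_rpow_lt u a hu h ha).le
    have h2 : u ^ α ≤ u ^ a := Real.rpow_le_rpow_of_exponent_ge hu h haα
    have h3 : 0 ≤ u ^ a := by positivity
    rw [abs_mul, abs_of_nonneg h3] at h1
    have : 0 ≤ u ^ α * u := by positivity
    nlinarith [abs_nonneg (Real.log u)]
  · have h1 : |Real.log u| ≤ u := by
      rw [abs_of_nonneg (Real.log_nonneg h)]
      linarith [Real.log_le_sub_one_of_pos hu]
    have : 0 ≤ 1 / a := by positivity
    have h3 : 0 ≤ u ^ α := by positivity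
    nlinarith

lemma rpow_log_exp_integrable {α : ℝ} (hα : 0 < α) :
    IntegrableOn (fun u : ℝ => u ^ α * Real.log u * Real.exp (-(u ^ α))) (Ioi 0) := by
  have h1 := (exp_integrable hα).const_mul (1 / α)
  have h2 := rpow_exp_integrable hα (q := α + 1) (by linarith)
  refine (h1.add h2).mono' (Measurable.aestronglyMeasurable (by fun_prop)) ?_
  refine (ae_restrict_iff' measurableSet_Ioi).2 (Eventually.of_forall fun u (hu : 0 < u) => ?_)
  have h := rpow_log_bound hα le_rfl hu
  have h3 : 0 ≤ u ^ α := by positivity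
  simp only [Pi.add_apply, norm_mul, Real.norm_eq_abs, abs_of_nonneg h3, Real.abs_exp,
    Real.rpow_add_one hu.ne']
  rw [← add_mul]
  gcongr

lemma stable_half (α z : ℝ) :
    stableDensity α z = Real.pi⁻¹ * ∫ u in Ioi 0, Real.cos (z * u) * Real.exp (-(u ^ α)) := by
  have h := integral_comp_abs (f := fun u => Real.cos (z * u) * Real.exp (-(u ^ α)))
  rw [stableDensity]
  have : ∫ u : ℝ, Real.cos (z * u) * Real.exp (-(|u| ^ α))
      = ∫ u : ℝ, Real.cos (z * |u|) * Real.exp (-(|u| ^ α)) := by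
    refine integral_congr_ae (Eventually.of_forall fun u => ?_)
    rcases abs_choice u with h | h <;> simp [h]
  rw [this, h, mul_inv]; ring

lemma stableDalpha_half (α z : ℝ) :
    stableDensityDalpha α z = -Real.pi⁻¹ *
      ∫ u in Ioi 0, Real.cos (z * u) * (u ^ α * Real.log u * Real.exp (-(u ^ α))) := by
  have h := integral_comp_abs
    (f := fun u => Real.cos (z * u) * (u ^ α * Real.log u * Real.exp (-(u ^ α))))
  rw [stableDensityDalpha]
  have : ∫ u : ℝ, Real.cos (z * u) * |u| ^ α * Real.log |u| * Real.exp (-(|u| ^ α))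
      = ∫ u : ℝ, Real.cos (z * |u|) * (|u| ^ α * Real.log |u| * Real.exp (-(|u| ^ α))) := by
    refine integral_congr_ae (Eventually.of_forall fun u => ?_)
    have : Real.cos (z * |u|) = Real.cos (z * u) := by
      rcases abs_choice u with h | h <;> simp [h]
    simp only [this]; ring
  rw [this, h, mul_inv]; ring

lemma bdd_mul_int {b S : ℝ → ℝ} (hb : Measurable b) (hb1 : ∀ x, |b x| ≤ 1)
    (hS : IntegrableOn S (Ioi 0)) : IntegrableOn (fun u => b u * S u) (Ioi 0) := by
  refine hS.norm.mono' (hb.aestronglyMeasurable.mul hS.aestronglyMeasurable)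
    (Eventually.of_forall fun x => ?_)
  rw [norm_mul, Real.norm_eq_abs]
  have := norm_nonneg (S x)
  nlinarith [hb1 x]

lemma stable_hasDeriv {α : ℝ} (hα : 0 < α) (z : ℝ) :
    HasDerivAt (stableDensity α)
      (Real.pi⁻¹ * ∫ u in Ioi 0, -Real.sin (z * u) * (u * Real.exp (-(u ^ α)))) z := by
  have h0 : stableDensity α = fun z =>
      Real.pi⁻¹ * ∫ u in Ioi 0, Real.cos (z * u) * Real.exp (-(u ^ α)) := funext (stable_half α)
  rw [h0]
  refine HasDerivAt.const_mul _ ?_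
  have hi : IntegrableOn (fun u : ℝ => u * Real.exp (-(u ^ α))) (Ioi 0) := by
    simpa using rpow_exp_integrable hα (q := 1) (by norm_num)
  refine (hasDerivAt_integral_of_dominated_loc_of_deriv_le
    (μ := volume.restrict (Ioi 0)) (F := fun z u => Real.cos (z * u) * Real.exp (-(u ^ α)))
    (F' := fun z u => -Real.sin (z * u) * (u * Real.exp (-(u ^ α))))
    (bound := fun u => u * Real.exp (-(u ^ α))) (s := univ) univ_mem ?_ ?_ ?_ ?_ hi ?_).2
  · exact Eventually.of_forall fun z => Measurable.aestronglyMeasurable (by fun_prop)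
  · exact bdd_mul_int (by fun_prop) (fun x => Real.abs_cos_le_one _) (exp_integrable hα)
  · exact Measurable.aestronglyMeasurable (by fun_prop)
  · refine (ae_restrict_iff' measurableSet_Ioi).2 (Eventually.of_forall fun u (hu : 0 < u) z _ => ?_)
    have h1 : 0 ≤ u * Real.exp (-(u ^ α)) := by positivity
    rw [norm_mul, norm_neg, Real.norm_of_nonneg h1]
    nlinarith [Real.abs_sin_le_one (z * u), Real.norm_eq_abs (Real.sin (z * u))]
  · refine Eventually.of_forall fun u z _ => ?_
    have hl : HasDerivAt (fun z : ℝ => z * u) u z := by simpa using (hasDerivAt_id z).mul_const u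
    exact (hl.cos.mul_const _).congr_deriv (by ring)

lemma Dstable {α : ℝ} (hα : 0 < α) (z : ℝ) :
    Dop (stableDensity α) z = Real.pi⁻¹ *
      ∫ u in Ioi 0, Real.cos (z * u) * (α * (u ^ α * Real.exp (-(u ^ α)))) := by
  rw [Dop, (stable_hasDeriv hα z).deriv, stable_half]
  have hi : IntegrableOn (fun u : ℝ => u * Real.exp (-(u ^ α))) (Ioi 0) := by
    simpa using rpow_exp_integrable hα (q := 1) (by norm_num)
  have hc : Measurable fun u => Real.cos (z * u) := by fun_prop
  have hs : Measurable fun u => -Real.sin (z * u) := by fun_prop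
  have i1 := bdd_mul_int hc (fun x => Real.abs_cos_le_one _) (exp_integrable hα)
  have i2 := bdd_mul_int hs (fun x => by rw [abs_neg]; exact Real.abs_sin_le_one _) hi
  have i3 := bdd_mul_int hc (fun x => Real.abs_cos_le_one _)
    ((rpow_exp_integrable hα (q := α) (by linarith)).const_mul α)
  have i4 := bdd_mul_int hc (fun x => Real.abs_cos_le_one _) hi
  have hder : ∀ u ∈ Ioi (0:ℝ), HasDerivAt (fun u => Real.cos (z * u) * (u * Real.exp (-(u ^ α))))
      (Real.cos (z * u) * Real.exp (-(u ^ α)) + z * (-Real.sin (z * u) * (u * Real.exp (-(u ^ α))))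
        - Real.cos (z * u) * (α * (u ^ α * Real.exp (-(u ^ α))))) u := by
    intro u hu
    have hu0 : (0:ℝ) < u := hu
    have hl : HasDerivAt (fun u : ℝ => z * u) z u := by simpa using (hasDerivAt_id u).const_mul z
    have he := ((Real.hasDerivAt_rpow_const (x := u) (p := α) (Or.inl hu0.ne')).neg).exp
    refine (hl.cos.mul ((hasDerivAt_id u).mul he)).congr_deriv ?_
    have : u ^ α = u ^ (α - 1) * u := by
      rw [← Real.rpow_add_one hu0.ne']; simp
    simp only [id, Pi.mul_apply, Pi.neg_apply]
    rw [show α * (u ^ α * Real.exp (-(u^α))) = α * ((u ^ (α - 1) * u) * Real.exp (-(u^α))) by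
      rw [← this]]
    ring
  have iT := (i1.add (i2.const_mul z)).sub i3
  have ht := tendsto_zero_of_hasDerivAt_of_integrableOn_Ioi hder iT i4
  have hcont : ContinuousWithinAt (fun u => Real.cos (z * u) * (u * Real.exp (-(u ^ α)))) (Ici 0) 0 := by
    apply Continuous.continuousWithinAt
    have : Continuous fun u : ℝ => u ^ α := Real.continuous_rpow_const hα.le
    fun_prop
  have h := integral_Ioi_of_hasDerivAt_of_tendsto hcont hder iT ht
  have i12 : IntegrableOn (fun u => Real.cos (z * u) * Real.exp (-(u ^ α))
    + z * (-Real.sin (z * u) * (u * Real.exp (-(u ^ α))))) (Ioi 0) := i1.add (i2.const_mul z)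
  rw [integral_sub i12 i3, integral_add i1 (i2.const_mul z), integral_const_mul] at h
  simp only [zero_mul, mul_zero, sub_zero] at h
  rw [← sub_eq_zero.1 h]; ring

lemma fFun_rep {α w : ℝ} (hα : 0 < α) (hw : 0 < w) (y : ℝ) :
    fFun α y w = Real.pi⁻¹ * ∫ u in Ioi 0,
      Real.cos (y * u) * Real.exp (-(u ^ 2) / 2) * Real.exp (-((w * u) ^ α)) := by
  rw [← conv_symbol gauss_cont gauss_integrable gauss_even gauss_cos (exp_integrable hα) hw, fFun,
    ← integral_const_mul]
  refine integral_congr_ae (Eventually.of_forall fun z => ?_)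
  simp only [stable_half]; ring

lemma gFun_rep {α w : ℝ} (hα : 0 < α) (hw : 0 < w) (y : ℝ) :
    gFun α y w = Real.pi⁻¹ * ∫ u in Ioi 0,
      Real.cos (y * u) * (u ^ 2 * Real.exp (-(u ^ 2) / 2)) * Real.exp (-((w * u) ^ α)) := by
  rw [← conv_symbol (κh := fun u => u ^ 2 * Real.exp (-(u ^ 2) / 2))
    Dgauss_cont Dgauss_integrable Dgauss_even Dgauss_cos (exp_integrable hα) hw, gFun,
    ← integral_const_mul]
  refine integral_congr_ae (Eventually.of_forall fun z => ?_)
  simp only [stable_half]; ring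

lemma hFun_rep {α w : ℝ} (hα : 0 < α) (hw : 0 < w) (y : ℝ) :
    hFun α y w = Real.pi⁻¹ * ∫ u in Ioi 0,
      Real.cos (y * u) * Real.exp (-(u ^ 2) / 2) *
        (α * ((w * u) ^ α * Real.exp (-((w * u) ^ α)))) := by
  rw [← conv_symbol (S := fun u => α * (u ^ α * Real.exp (-(u ^ α))))
    gauss_cont gauss_integrable gauss_even gauss_cos
    ((rpow_exp_integrable hα (by linarith)).const_mul α) hw, hFun,
    ← integral_const_mul]
  refine integral_congr_ae (Eventually.of_forall fun z => ?_)
  simp only [Dstable hα]; ring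

lemma kFun_rep {α w : ℝ} (hα : 0 < α) (hw : 0 < w) (y : ℝ) :
    kFun α y w = -Real.pi⁻¹ * ∫ u in Ioi 0,
      Real.cos (y * u) * Real.exp (-(u ^ 2) / 2) *
        ((w * u) ^ α * Real.log (w * u) * Real.exp (-((w * u) ^ α))) := by
  rw [← conv_symbol (S := fun u => u ^ α * Real.log u * Real.exp (-(u ^ α)))
    gauss_cont gauss_integrable gauss_even gauss_cos (rpow_log_exp_integrable hα) hw, kFun,
    ← integral_const_mul]
  refine integral_congr_ae (Eventually.of_forall fun z => ?_)
  simp only [stableDalpha_half]; ring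

lemma half_transform {κ : ℝ → ℝ} (he : ∀ x, κ (-x) = κ x) (y : ℝ) :
    ∫ u in Ioi 0, Real.cos (y * u) * κ u = (∫ u, Real.cos (y * u) * κ u) / 2 := by
  have h := integral_comp_abs (f := fun u => Real.cos (y * u) * κ u)
  have h2 : ∫ u : ℝ, Real.cos (y * |u|) * κ |u| = ∫ u, Real.cos (y * u) * κ u := by
    refine integral_congr_ae (Eventually.of_forall fun u => ?_)
    rcases abs_choice u with h | h <;> simp [h, he]
  rw [← h2, h]; ring

lemma exp_eq_gauss (u : ℝ) :
    Real.exp (-(u ^ 2) / 2) = Real.sqrt (2 * Real.pi) * gauss u := by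
  have : Real.sqrt (2 * Real.pi) ≠ 0 := by positivity
  rw [gauss, mul_inv_cancel_left₀ this]

/-- Gaussian inversion -/
lemma gauss_rep (y : ℝ) :
    gauss y = Real.pi⁻¹ * ∫ u in Ioi 0, Real.cos (y * u) * Real.exp (-(u ^ 2) / 2) := by
  have h3 : ∫ u in Ioi 0, Real.cos (y * u) * Real.exp (-(u ^ 2) / 2)
      = Real.sqrt (2 * Real.pi) * ∫ u in Ioi 0, Real.cos (y * u) * gauss u := by
    rw [← integral_const_mul]
    refine integral_congr_ae (Eventually.of_forall fun u => ?_)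
    simp only [exp_eq_gauss]; ring
  rw [h3, half_transform gauss_even, gauss_cos, exp_eq_gauss]
  have hs : Real.sqrt (2 * Real.pi) * Real.sqrt (2 * Real.pi) = 2 * Real.pi :=
    Real.mul_self_sqrt (by positivity)
  have hp := Real.pi_pos.ne'
  calc gauss y = Real.pi⁻¹ * (2 * Real.pi) * gauss y / 2 := by field_simp
    _ = _ := by generalize Real.sqrt (2 * Real.pi) = r at hs ⊢; rw [← hs]; ring

lemma Dgauss_rep (y : ℝ) :
    Dop gauss y = Real.pi⁻¹ * ∫ u in Ioi 0,
      Real.cos (y * u) * (u ^ 2 * Real.exp (-(u ^ 2) / 2)) := by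
  have c1 := (cos_mul_integrable Dgauss_cont Dgauss_integrable y 0).integrableOn (s := Ioi 0)
  have c2 := (cos_mul_integrable gauss_cont gauss_integrable y 0).integrableOn (s := Ioi 0)
  simp only [add_zero] at c1 c2
  have h3 : ∫ u in Ioi 0, Real.cos (y * u) * (u ^ 2 * Real.exp (-(u ^ 2) / 2))
      = Real.sqrt (2 * Real.pi) * ∫ u in Ioi 0, (Real.cos (y * u) * gauss u
        - Real.cos (y * u) * Dop gauss u) := by
    rw [← integral_const_mul]
    refine integral_congr_ae (Eventually.of_forall fun u => ?_)
    simp only [exp_eq_gauss, Dop_gauss]; ring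
  rw [h3, integral_sub c2 c1, half_transform gauss_even, half_transform Dgauss_even, gauss_cos,
    Dgauss_cos, exp_eq_gauss, Dop_gauss]
  have hs : Real.sqrt (2 * Real.pi) * Real.sqrt (2 * Real.pi) = 2 * Real.pi :=
    Real.mul_self_sqrt (by positivity)
  have hp := Real.pi_pos.ne'
  calc (1 - y ^ 2) * gauss y = Real.pi⁻¹ * (2 * Real.pi) * ((1 - y ^ 2) * gauss y) / 2 := by
        field_simp
    _ = _ := by generalize Real.sqrt (2 * Real.pi) = r at hs ⊢; rw [← hs]; ring



/-- `F` has three Euler derivatives `(u d/du)^k F`, all dominated by `M * b`. -/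
def Eul (b : ℝ → ℝ) (M : ℝ) (F : ℝ → ℝ) : Prop :=
  ∃ F1 F2 F3 : ℝ → ℝ, ∀ u, 0 < u →
    (HasDerivAt F (F1 u / u) u ∧ HasDerivAt F1 (F2 u / u) u ∧ HasDerivAt F2 (F3 u / u) u) ∧
    |F u| ≤ M * b u ∧ |F1 u| ≤ M * b u ∧ |F2 u| ≤ M * b u ∧ |F3 u| ≤ M * b u

lemma Eul.mul {b c : ℝ → ℝ} {M N : ℝ} {F G : ℝ → ℝ} (hF : Eul b M F) (hG : Eul c N G) :
    Eul (fun u => b u * c u) (8 * (M * N)) (fun u => F u * G u) := by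
  obtain ⟨F1, F2, F3, hF⟩ := hF
  obtain ⟨G1, G2, G3, hG⟩ := hG
  refine ⟨fun u => F1 u * G u + F u * G1 u, fun u => F2 u * G u + 2 * (F1 u * G1 u) + F u * G2 u,
    fun u => F3 u * G u + 3 * (F2 u * G1 u) + 3 * (F1 u * G2 u) + F u * G3 u, fun u hu => ?_⟩
  obtain ⟨⟨a1, a2, a3⟩, b0, b1, b2, b3⟩ := hF u hu
  obtain ⟨⟨a1', a2', a3'⟩, c0, c1, c2, c3⟩ := hG u hu
  have key : ∀ {x y : ℝ}, |x| ≤ M * b u → |y| ≤ N * c u → |x * y| ≤ M * N * (b u * c u) := by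
    intro x y hx hy
    rw [abs_mul]
    calc |x| * |y| ≤ (M * b u) * (N * c u) :=
          mul_le_mul hx hy (abs_nonneg _) ((abs_nonneg _).trans hx)
      _ = _ := by ring
  refine ⟨⟨?_, ?_, ?_⟩, ?_, ?_, ?_, ?_⟩
  · exact (a1.mul a1').congr_deriv (by ring)
  · exact ((a2.mul a1').add (a1.mul a2')).congr_deriv (by ring)
  · exact (((a3.mul a1').add ((a2.mul a2').const_mul 2)).add (a1.mul a3')).congr_deriv (by ring)
  · have h := key b0 c0
    have := (abs_nonneg _).trans h
    linarith
  · have h1 := key b1 c0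
    have h2 := key b0 c1
    have := (abs_nonneg _).trans h1
    rw [abs_le] at *
    constructor <;> linarith [h1.1, h1.2, h2.1, h2.2]
  · have h1 := key b2 c0
    have h2 := key b1 c1
    have h3 := key b0 c2
    have := (abs_nonneg _).trans h1
    rw [abs_le] at *
    constructor <;> linarith [h1.1, h1.2, h2.1, h2.2, h3.1, h3.2]
  · have h1 := key b3 c0
    have h2 := key b2 c1
    have h3 := key b1 c2
    have h4 := key b0 c3
    have := (abs_nonneg _).trans h1
    rw [abs_le] at *
    constructor <;> linarith [h1.1, h1.2, h2.1, h2.2, h3.1, h3.2, h4.1, h4.2]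

lemma Eul.mono {b c : ℝ → ℝ} {M N : ℝ} {F : ℝ → ℝ} (hF : Eul b M F)
    (h : ∀ u, 0 < u → M * b u ≤ N * c u) : Eul c N F := by
  obtain ⟨F1, F2, F3, hF⟩ := hF
  refine ⟨F1, F2, F3, fun u hu => ?_⟩
  obtain ⟨a, b0, b1, b2, b3⟩ := hF u hu
  have := h u hu
  exact ⟨a, b0.trans this, b1.trans this, b2.trans this, b3.trans this⟩

lemma Eul.contOn {b : ℝ → ℝ} {M : ℝ} {F : ℝ → ℝ} (hF : Eul b M F) : ContinuousOn F (Ioi 0) := by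
  obtain ⟨F1, F2, F3, hF⟩ := hF
  exact fun u hu => (hF u hu).1.1.continuousAt.continuousWithinAt

lemma Eul.bound {b : ℝ → ℝ} {M : ℝ} {F : ℝ → ℝ} (hF : Eul b M F) (u : ℝ) (hu : 0 < u) :
    |F u| ≤ M * b u := by
  obtain ⟨F1, F2, F3, hF⟩ := hF
  exact (hF u hu).2.1

lemma gamma_int {s : ℝ} (hs : -1 < s) :
    IntegrableOn (fun u : ℝ => u ^ s * Real.exp (-u)) (Ioi 0) := by
  have := Real.GammaIntegral_convergent (s := s + 1) (by linarith)
  refine this.congr_fun (fun u _ => ?_) measurableSet_Ioi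
  simp [mul_comm]

lemma Eul.cos_int {α M : ℝ} (hα : 0 < α) {F : ℝ → ℝ}
    (hF : Eul (fun u => u ^ α * Real.exp (-u)) M F) (y : ℝ) :
    IntegrableOn (fun u => Real.cos (y * u) * F u) (Ioi 0) := by
  refine ((gamma_int (s := α) (by linarith)).const_mul M).mono' ?_ ?_
  · exact (((by fun_prop : Continuous fun u => Real.cos (y * u)).continuousOn).mul
      hF.contOn).aestronglyMeasurable measurableSet_Ioi
  · refine (ae_restrict_iff' measurableSet_Ioi).2 (Eventually.of_forall fun u (hu : 0 < u) => ?_)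
    have := hF.bound u hu
    rw [norm_mul, Real.norm_eq_abs, Real.norm_eq_abs]
    nlinarith [Real.abs_cos_le_one (y * u), abs_nonneg (F u)]

lemma decay_bdd {α M : ℝ} (hα : 0 < α) (hα2 : α < 2) {F : ℝ → ℝ}
    (hF : Eul (fun u => u ^ α * Real.exp (-u)) M F) (y : ℝ) :
    |∫ u in Ioi 0, Real.cos (y * u) * F u| ≤ 3 * M := by
  have hM : 0 ≤ M := by
    have := (abs_nonneg _).trans (hF.bound 1 one_pos)
    simp at this
    have h2 := Real.exp_pos (-1)
    by_contra hneg
    push Not at hneg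
    nlinarith
  have g0 := gamma_int (s := 0) (by norm_num)
  have g2 := gamma_int (s := 2) (by norm_num)
  have h : ∫ u in Ioi 0, M * (u ^ (0:ℝ) * Real.exp (-u) + u ^ (2:ℝ) * Real.exp (-u)) = 3 * M := by
    rw [integral_const_mul, integral_add g0 g2]
    have e0 : ∫ u in Ioi 0, u ^ (0:ℝ) * Real.exp (-u) = 1 := by
      have := Real.Gamma_eq_integral (s := 1) (by norm_num)
      rw [Real.Gamma_one] at this
      rw [this]; simp
    have e2 : ∫ u in Ioi 0, u ^ (2:ℝ) * Real.exp (-u) = 2 := by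
      have := Real.Gamma_eq_integral (s := 3) (by norm_num)
      rw [show (3:ℝ) = ((2:ℕ):ℝ) + 1 by norm_num, Real.Gamma_nat_eq_factorial] at this
      have e : ∫ u in Ioi 0, u ^ (2:ℝ) * Real.exp (-u)
        = ∫ u in Ioi 0, Real.exp (-u) * u ^ (((2:ℕ):ℝ) + 1 - 1) := by
        refine setIntegral_congr_fun measurableSet_Ioi fun u _ => ?_
        simp [mul_comm]
      rw [e, ← this]; norm_num [Nat.factorial]
    rw [e0, e2]; ring
  rw [← h, ← Real.norm_eq_abs]
  refine norm_integral_le_of_norm_le ((g0.add g2).const_mul M) ?_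
  refine (ae_restrict_iff' measurableSet_Ioi).2 (Eventually.of_forall fun u (hu : 0 < u) => ?_)
  have h1 := hF.bound u hu
  rw [norm_mul, Real.norm_eq_abs, Real.norm_eq_abs]
  have h2 : |Real.cos (y * u)| * |F u| ≤ M * (u ^ α * Real.exp (-u)) := by
    nlinarith [Real.abs_cos_le_one (y * u), abs_nonneg (F u)]
  refine h2.trans ?_
  rw [← add_mul]
  gcongr
  rcases le_total u 1 with h | h
  · have := Real.rpow_le_one hu.le h hα.le
    have : 0 ≤ u ^ (2:ℝ) := by positivity
    rw [Real.rpow_zero]; linarith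
  · have := Real.rpow_le_rpow_of_exponent_le h hα2.le
    rw [Real.rpow_zero]; linarith

lemma decay_tail {α M b : ℝ} (hα : 0 < α) (hαb : α ≤ b) (hb : b < 2) {F : ℝ → ℝ}
    (hF : Eul (fun u => u ^ α * Real.exp (-u)) M F) {y : ℝ} (hy : 1 ≤ y) :
    |∫ u in Ioi 0, Real.cos (y * u) * F u| ≤ (5 + 6 / (2 - b)) * M * y⁻¹ ^ (α + 1) := by
  have hM : 0 ≤ M := by
    have := (abs_nonneg _).trans (hF.bound 1 one_pos)
    simp at this
    have h2 := Real.exp_pos (-1)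
    by_contra hneg
    push Not at hneg
    nlinarith
  have hy0 : 0 < y := by linarith
  have hintg := hF.cos_int hα y
  obtain ⟨F1, F2, F3, hF⟩ := hF
  set δ := y⁻¹ with hδ
  have hδ0 : 0 < δ := inv_pos.mpr hy0
  -- small part
  have hsplit : ∫ u in Ioi 0, Real.cos (y * u) * F u
      = (∫ u in Ioc 0 δ, Real.cos (y * u) * F u) + ∫ u in Ioi δ, Real.cos (y * u) * F u := by
    rw [← setIntegral_union Ioc_disjoint_Ioi_same measurableSet_Ioi
      (hintg.mono_set Ioc_subset_Ioi_self) (hintg.mono_set (Ioi_subset_Ioi hδ0.le)),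
      Ioc_union_Ioi_eq_Ioi hδ0.le]
  have hsmall : |∫ u in Ioc 0 δ, Real.cos (y * u) * F u| ≤ M * δ ^ (α + 1) := by
    have := norm_setIntegral_le_of_norm_le_const (μ := volume) (s := Ioc 0 δ)
      (f := fun u => Real.cos (y * u) * F u) (C := M * δ ^ α) (by simp) (fun u hu => by
        have h1 := (hF u hu.1).2.1
        have h2 : u ^ α ≤ δ ^ α := Real.rpow_le_rpow hu.1.le hu.2 hα.le
        have h3 : Real.exp (-u) ≤ 1 := Real.exp_le_one_iff.2 (by linarith [hu.1])
        have h4 : u ^ α * Real.exp (-u) ≤ δ ^ α * 1 :=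
          mul_le_mul h2 h3 (Real.exp_pos _).le (by positivity)
        rw [norm_mul, Real.norm_eq_abs, Real.norm_eq_abs]
        have h5 : |Real.cos (y * u)| * |F u| ≤ 1 * |F u| := by
          gcongr; exact Real.abs_cos_le_one _
        have h6 : M * (u ^ α * Real.exp (-u)) ≤ M * (δ ^ α * 1) := by gcongr
        linarith)
    refine this.trans (le_of_eq ?_)
    rw [Real.rpow_add_one hδ0.ne']
    simp [Measure.real, hδ0.le]
    ring
  -- integration by parts
  set Q : ℝ → ℝ := fun u => (F3 u - 3 * F2 u + 2 * F1 u) / u ^ 3 with hQ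
  set P : ℝ → ℝ := fun u => δ * (Real.sin (y * u) * F u) + δ ^ 2 * (Real.cos (y * u) * (F1 u / u))
    - δ ^ 3 * (Real.sin (y * u) * ((F2 u - F1 u) / u ^ 2)) with hP
  have hyδ : y * δ = 1 := mul_inv_cancel₀ hy0.ne'
  have hd2 : ∀ u, 0 < u → HasDerivAt (fun u => (F2 u - F1 u) / u ^ 2) (Q u) u := by
    intro u hu
    obtain ⟨⟨a1, a2, a3⟩, -⟩ := hF u hu
    refine ((a3.sub a2).div (hasDerivAt_pow 2 u) (by positivity)).congr_deriv ?_
    simp only [hQ, Pi.sub_apply]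
    field_simp
    ring
  have hd1 : ∀ u, 0 < u → HasDerivAt (fun u => F1 u / u) ((F2 u - F1 u) / u ^ 2) u := by
    intro u hu
    obtain ⟨⟨a1, a2, a3⟩, -⟩ := hF u hu
    refine (a2.div (hasDerivAt_id u) hu.ne').congr_deriv ?_
    simp only [id]
    field_simp
  have hder : ∀ u ∈ Ici δ, HasDerivAt P (Real.cos (y * u) * F u - δ ^ 3 * (Real.sin (y * u) * Q u)) u := by
    intro u hu
    have hu0 : 0 < u := hδ0.trans_le hu
    obtain ⟨⟨a1, a2, a3⟩, -⟩ := hF u hu0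
    have hl : HasDerivAt (fun u : ℝ => y * u) y u := by simpa using (hasDerivAt_id u).const_mul y
    refine ((((hl.sin.mul a1).const_mul δ).add ((hl.cos.mul (hd1 u hu0)).const_mul (δ ^ 2))).sub
      ((hl.sin.mul (hd2 u hu0)).const_mul (δ ^ 3))).congr_deriv ?_
    linear_combination (Real.cos (y * u) * F u - δ * Real.sin (y*u) * (F1 u / u)
      - δ ^ 2 * Real.cos (y * u) * ((F2 u - F1 u) / u ^ 2)) * hyδ
  have hQb : ∀ u ∈ Ioi δ, ‖Real.sin (y * u) * Q u‖ ≤ 6 * M * u ^ (α - 3) := by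
    intro u hu
    have hu0 : 0 < u := hδ0.trans hu
    obtain ⟨-, b0, b1, b2, b3⟩ := hF u hu0
    have h3 : Real.exp (-u) ≤ 1 := Real.exp_le_one_iff.2 (by linarith)
    have h4 : M * (u ^ α * Real.exp (-u)) ≤ M * (u ^ α * 1) := by gcongr
    rw [norm_mul, Real.norm_eq_abs, Real.norm_eq_abs]
    have h5 : |Q u| ≤ 6 * M * u ^ (α - 3) := by
      rw [hQ, abs_div, abs_of_pos (by positivity : 0 < u ^ 3), div_le_iff₀ (by positivity)]
      rw [show 6 * M * u ^ (α - 3) * u ^ 3 = 6 * M * u ^ α by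
        rw [mul_assoc, ← Real.rpow_natCast u 3, ← Real.rpow_add hu0]; norm_num]
      rw [abs_le] at *
      constructor <;> linarith [b1.1, b1.2, b2.1, b2.2, b3.1, b3.2]
    calc _ ≤ 1 * |Q u| := by gcongr; exact Real.abs_sin_le_one _
      _ ≤ _ := by rw [one_mul]; exact h5
  have hri : IntegrableOn (fun u : ℝ => 6 * M * u ^ (α - 3)) (Ioi δ) :=
    (integrableOn_Ioi_rpow_of_lt (by linarith) hδ0).const_mul _
  have hQm : AEStronglyMeasurable (fun u => Real.sin (y * u) * Q u) (volume.restrict (Ioi δ)) := by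
    refine (Continuous.aestronglyMeasurable (by fun_prop)).mul ?_
    refine ((measurable_deriv (fun u => (F2 u - F1 u) / u ^ 2)).aestronglyMeasurable).congr ?_
    exact (ae_restrict_iff' measurableSet_Ioi).2 (Eventually.of_forall fun u hu =>
      (hd2 u (hδ0.trans hu)).deriv)
  have hQae : ∀ᵐ u ∂(volume.restrict (Ioi δ)), ‖Real.sin (y * u) * Q u‖ ≤ 6 * M * u ^ (α - 3) :=
    (ae_restrict_iff' measurableSet_Ioi).2 (Eventually.of_forall hQb)
  have hQi : IntegrableOn (fun u => Real.sin (y * u) * Q u) (Ioi δ) := hri.mono' hQm hQae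
  have hPb : ∀ u, 0 < u → |P u| ≤ M * (u ^ α * Real.exp (-u)) * (δ + δ ^ 2 / u + 2 * δ ^ 3 / u ^ 2) := by
    intro u hu
    obtain ⟨-, b0, b1, b2, b3⟩ := hF u hu
    have s1 := Real.abs_sin_le_one (y * u)
    have s2 := Real.abs_cos_le_one (y * u)
    have h1 : |δ * (Real.sin (y * u) * F u)| ≤ δ * (M * (u ^ α * Real.exp (-u))) := by
      rw [abs_mul, abs_mul, abs_of_pos hδ0]
      refine mul_le_mul_of_nonneg_left ?_ hδ0.le
      nlinarith [abs_nonneg (F u)]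
    have h2 : |δ ^ 2 * (Real.cos (y * u) * (F1 u / u))| ≤ δ ^ 2 * (M * (u ^ α * Real.exp (-u)) / u) := by
      rw [abs_mul, abs_mul, abs_of_pos (by positivity : 0 < δ ^ 2), abs_div, abs_of_pos hu]
      gcongr
      have : |F1 u| / u ≤ M * (u ^ α * Real.exp (-u)) / u := by gcongr
      have h0 : 0 ≤ |F1 u| / u := by positivity
      nlinarith
    have h3 : |δ ^ 3 * (Real.sin (y * u) * ((F2 u - F1 u) / u ^ 2))|
        ≤ δ ^ 3 * (2 * (M * (u ^ α * Real.exp (-u))) / u ^ 2) := by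
      rw [abs_mul, abs_mul, abs_of_pos (by positivity : 0 < δ ^ 3), abs_div,
        abs_of_pos (by positivity : 0 < u ^ 2)]
      gcongr
      have : |F2 u - F1 u| / u ^ 2 ≤ 2 * (M * (u ^ α * Real.exp (-u))) / u ^ 2 := by
        gcongr
        exact (abs_sub _ _).trans (by linarith)
      have h0 : 0 ≤ |F2 u - F1 u| / u ^ 2 := by positivity
      nlinarith
    calc |P u| ≤ |δ * (Real.sin (y * u) * F u)| + |δ ^ 2 * (Real.cos (y * u) * (F1 u / u))|
          + |δ ^ 3 * (Real.sin (y * u) * ((F2 u - F1 u) / u ^ 2))| :=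
          (abs_sub _ _).trans (by gcongr; exact abs_add_le _ _)
      _ ≤ _ := add_le_add (add_le_add h1 h2) h3
      _ = _ := by ring
  have htend : Tendsto P atTop (𝓝 0) := by
    have t := tendsto_rpow_mul_exp_neg_mul_atTop_nhds_zero α 1 one_pos
    have t2 := t.const_mul (M * (δ + δ ^ 2 + 2 * δ ^ 3))
    rw [mul_zero] at t2
    refine squeeze_zero_norm' ?_ t2
    filter_upwards [eventually_ge_atTop 1] with u hu
    have hu0 : 0 < u := by linarith
    refine (hPb u hu0).trans ?_
    have e1 : δ ^ 2 / u ≤ δ ^ 2 := div_le_self (by positivity) hu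
    have e2 : 2 * δ ^ 3 / u ^ 2 ≤ 2 * δ ^ 3 := div_le_self (by positivity) (one_le_pow₀ hu)
    rw [show M * (δ + δ ^ 2 + 2 * δ ^ 3) * (u ^ α * Real.exp (-1 * u))
      = M * (u ^ α * Real.exp (-u)) * (δ + δ ^ 2 + 2 * δ ^ 3) by rw [neg_one_mul]; ring]
    gcongr
  have hcosi : IntegrableOn (fun u => Real.cos (y * u) * F u) (Ioi δ) :=
    hintg.mono_set (Ioi_subset_Ioi hδ0.le)
  have hI := integral_Ioi_of_hasDerivAt_of_tendsto' hder (hcosi.sub (hQi.const_mul _)) htend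
  rw [integral_sub hcosi (hQi.const_mul _), integral_const_mul] at hI
  have hPδ : |P δ| ≤ 4 * M * δ ^ (α + 1) := by
    refine (hPb δ hδ0).trans ?_
    have h3 : Real.exp (-δ) ≤ 1 := Real.exp_le_one_iff.2 (by linarith)
    have : δ + δ ^ 2 / δ + 2 * δ ^ 3 / δ ^ 2 = 4 * δ := by field_simp; ring
    rw [this, Real.rpow_add_one hδ0.ne']
    have h4 : M * (δ ^ α * Real.exp (-δ)) ≤ M * (δ ^ α * 1) := by gcongr
    nlinarith
  have hQI : |∫ u in Ioi δ, Real.sin (y * u) * Q u| ≤ 6 * M * (δ ^ (α - 2) / (2 - α)) := by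
    have := norm_integral_le_of_norm_le hri hQae
    rw [integral_const_mul, integral_Ioi_rpow_of_lt (by linarith) hδ0] at this
    refine this.trans (le_of_eq ?_)
    rw [show α - 3 + 1 = -(2 - α) by ring, neg_div_neg_eq, show -(2 - α) = α - 2 by ring]
  have hQ2 : |δ ^ 3 * ∫ u in Ioi δ, Real.sin (y * u) * Q u| ≤ 6 / (2 - b) * M * δ ^ (α + 1) := by
    rw [abs_mul, abs_of_pos (by positivity : 0 < δ ^ 3)]
    calc _ ≤ δ ^ 3 * (6 * M * (δ ^ (α - 2) / (2 - α))) := by gcongr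
      _ = 6 / (2 - α) * M * δ ^ (α + 1) := by
        rw [show α + 1 = (α - 2) + (3:ℕ) by push_cast; ring, Real.rpow_add hδ0, Real.rpow_natCast]
        ring
      _ ≤ _ := by
        gcongr
  rw [hsplit]
  have e : ∫ u in Ioi δ, Real.cos (y * u) * F u = -P δ + δ ^ 3 * ∫ u in Ioi δ, Real.sin (y * u) * Q u := by
    linarith
  rw [e]
  rw [abs_le] at *
  constructor <;> linarith [hsmall.1, hsmall.2, hPδ.1, hPδ.2, hQ2.1, hQ2.2]



lemma pow_le_exp {u : ℝ} (hu : 0 ≤ u) (n : ℕ) : u ^ n ≤ n.factorial * Real.exp u := by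
  have := Real.pow_div_factorial_le_exp u hu n
  rwa [div_le_iff₀ (by positivity), mul_comm] at this

lemma eul_gauss : ∃ M > 0, Eul (fun u => Real.exp (-(6 * u))) M (fun u => Real.exp (-(u ^ 2) / 2)) := by
  refine ⟨5000 * Real.exp 25, by positivity, fun u => -u ^ 2 * Real.exp (-(u ^ 2) / 2),
    fun u => (u ^ 4 - 2 * u ^ 2) * Real.exp (-(u ^ 2) / 2),
    fun u => (-u ^ 6 + 6 * u ^ 4 - 4 * u ^ 2) * Real.exp (-(u ^ 2) / 2), fun u hu => ?_⟩
  have hE : HasDerivAt (fun u : ℝ => Real.exp (-(u ^ 2) / 2)) (-u * Real.exp (-(u ^ 2) / 2)) u := by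
    have h : HasDerivAt (fun x : ℝ => -(x ^ 2) / 2) (-u) u := by
      have := ((hasDerivAt_pow 2 u).neg.div_const 2)
      exact this.congr_deriv (by simp; ring)
    exact h.exp.congr_deriv (by ring)
  have e2 := pow_le_exp hu.le 2
  have e4 := pow_le_exp hu.le 4
  have e6 := pow_le_exp hu.le 6
  norm_num [Nat.factorial] at e2 e4 e6
  have e0 : 1 ≤ Real.exp u := Real.one_le_exp hu.le
  have hk : Real.exp u * Real.exp (-(u ^ 2) / 2) ≤ Real.exp 25 * Real.exp (-(6 * u)) := by
    rw [← Real.exp_add, ← Real.exp_add]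
    apply Real.exp_le_exp.2
    nlinarith [sq_nonneg (u - 7)]
  have hpos := Real.exp_pos (-(u ^ 2) / 2)
  have key : ∀ p : ℝ, |p| ≤ 5000 * Real.exp u →
      |p * Real.exp (-(u ^ 2) / 2)| ≤ 5000 * Real.exp 25 * Real.exp (-(6 * u)) := by
    intro p hp
    rw [abs_mul, Real.abs_exp]
    nlinarith
  have p2 : 0 ≤ u ^ 2 := by positivity
  have p4 : 0 ≤ u ^ 4 := by positivity
  have p6 : 0 ≤ u ^ 6 := by positivity
  refine ⟨⟨?_, ?_, ?_⟩, ?_, ?_, ?_, ?_⟩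
  · refine hE.congr_deriv ?_
    field_simp
  · refine ((hasDerivAt_pow 2 u).neg.mul hE).congr_deriv ?_
    simp only [Pi.neg_apply]
    field_simp
    push_cast; ring
  · refine (((hasDerivAt_pow 4 u).sub ((hasDerivAt_pow 2 u).const_mul 2)).mul hE).congr_deriv ?_
    simp only [Pi.sub_apply]
    field_simp
    push_cast; ring
  · simpa using key 1 (by rw [abs_one]; linarith)
  · exact key _ (by rw [abs_le]; constructor <;> linarith)
  · exact key _ (by rw [abs_le]; constructor <;> linarith)
  · exact key _ (by rw [abs_le]; constructor <;> linarith)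

lemma hasDeriv_v {α s u : ℝ} (hu : 0 < u) :
    HasDerivAt (fun u : ℝ => s * u ^ α) (α * (s * u ^ α) / u) u := by
  refine ((Real.hasDerivAt_rpow_const (x := u) (p := α) (Or.inl hu.ne')).const_mul s).congr_deriv ?_
  rw [Real.rpow_sub_one hu.ne']; ring

lemma alpha_pow_bd {α x B : ℝ} (n : ℕ) (hn : n ≤ 3) (h0 : 0 ≤ α) (h2 : α ≤ 2) (hx : |x| ≤ B) :
    |α ^ n * x| ≤ 8 * B := by
  have : α ^ n ≤ 8 := by
    calc α ^ n ≤ 2 ^ n := by gcongr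
      _ ≤ 2 ^ 3 := by gcongr; norm_num
      _ = 8 := by norm_num
  rw [abs_mul, abs_of_nonneg (by positivity)]
  exact mul_le_mul this hx (abs_nonneg _) (by norm_num)

lemma eul_v {α s : ℝ} (h0 : 0 ≤ α) (h2 : α ≤ 2) (hs : 0 ≤ s) :
    Eul (fun u => s * u ^ α) 8 (fun u => s * u ^ α) := by
  refine ⟨fun u => α ^ 1 * (s * u ^ α), fun u => α ^ 2 * (s * u ^ α), fun u => α ^ 3 * (s * u ^ α),
    fun u hu => ?_⟩
  have hd := hasDeriv_v (α := α) (s := s) hu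
  have hb : |s * u ^ α| ≤ s * u ^ α := by rw [abs_of_nonneg (by positivity)]
  refine ⟨⟨hd.congr_deriv (by ring), (hd.const_mul _).congr_deriv (by ring),
    (hd.const_mul _).congr_deriv (by ring)⟩, ?_, ?_, ?_, ?_⟩
  · simpa using alpha_pow_bd 0 (by norm_num) h0 h2 hb
  · exact alpha_pow_bd 1 (by norm_num) h0 h2 hb
  · exact alpha_pow_bd 2 (by norm_num) h0 h2 hb
  · exact alpha_pow_bd 3 (by norm_num) h0 h2 hb

lemma exp_facts {v : ℝ} (hv : 0 ≤ v) : 0 < Real.exp (-v) ∧ Real.exp (-v) ≤ 1 ∧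
    v * Real.exp (-v) ≤ 1 ∧ v ^ 2 * Real.exp (-v) ≤ 2 ∧ 1 - v ≤ Real.exp (-v) ∧
    Real.exp (-v) - 1 + v ≤ v ^ 2 := by
  have h1 := pow_le_exp hv 1
  have h2 := pow_le_exp hv 2
  norm_num [Nat.factorial] at h1 h2
  have hp := Real.exp_pos v
  refine ⟨Real.exp_pos _, Real.exp_le_one_iff.2 (by linarith), ?_, ?_, ?_, ?_⟩
  · rw [Real.exp_neg, ← div_eq_mul_inv, div_le_one hp]; exact h1
  · rw [Real.exp_neg, ← div_eq_mul_inv, div_le_iff₀ hp]; exact h2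
  · linarith [Real.add_one_le_exp (-v)]
  · rcases le_total v 1 with h | h
    · have := Real.abs_exp_sub_one_sub_id_le (x := -v) (by rw [abs_neg, abs_of_nonneg hv]; exact h)
      have := (abs_le.1 this).2
      nlinarith
    · have : Real.exp (-v) ≤ 1 := Real.exp_le_one_iff.2 (by linarith)
      nlinarith

lemma hasDeriv_ev {α s u : ℝ} (hu : 0 < u) :
    HasDerivAt (fun u : ℝ => Real.exp (-(s * u ^ α)))
      (-α * (s * u ^ α) * Real.exp (-(s * u ^ α)) / u) u := by
  refine ((hasDeriv_v (α := α) (s := s) hu).neg.exp).congr_deriv ?_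
  simp only [Pi.neg_apply]
  ring

lemma eul_one_sub {α s : ℝ} (h0 : 0 ≤ α) (h2 : α ≤ 2) (hs : 0 ≤ s) :
    Eul (fun u => s * u ^ α) 64 (fun u => 1 - Real.exp (-(s * u ^ α))) := by
  refine ⟨fun u => α ^ 1 * (s * u ^ α * Real.exp (-(s * u ^ α))),
    fun u => α ^ 2 * ((s * u ^ α - (s * u ^ α) ^ 2) * Real.exp (-(s * u ^ α))),
    fun u => α ^ 3 * ((s * u ^ α - 3 * (s * u ^ α) ^ 2 + (s * u ^ α) ^ 3) * Real.exp (-(s * u ^ α))),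
    fun u hu => ?_⟩
  have hd := hasDeriv_v (α := α) (s := s) hu
  have he := hasDeriv_ev (α := α) (s := s) hu
  have hv : 0 ≤ s * u ^ α := by positivity
  refine ⟨⟨?_, ?_, ?_⟩, ?_⟩
  · refine (he.const_sub 1).congr_deriv ?_
    ring
  · refine ((hd.mul he).const_mul _).congr_deriv ?_
    ring
  · refine (((hd.sub (hd.pow 2)).mul he).const_mul _).congr_deriv ?_
    simp only [Pi.sub_apply, Pi.pow_apply]
    push_cast
    ring
  · beta_reduce
    generalize s * u ^ α = v at hv ⊢
    obtain ⟨p, f0, f1, f2, f3, f4⟩ := exp_facts hv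
    have g1 : 0 ≤ v * Real.exp (-v) := by positivity
    have g1' : v * Real.exp (-v) ≤ v := by nlinarith
    have g2 : 0 ≤ v ^ 2 * Real.exp (-v) := by positivity
    have g2' : v ^ 2 * Real.exp (-v) ≤ v := by nlinarith
    have g3 : 0 ≤ v ^ 3 * Real.exp (-v) := by positivity
    have g3' : v ^ 3 * Real.exp (-v) ≤ 2 * v := by nlinarith
    refine ⟨?_, ?_, ?_, ?_⟩
    · rw [abs_le]; constructor <;> linarith
    · refine (alpha_pow_bd 1 (by norm_num) h0 h2 (B := 8 * v) ?_).trans (by linarith)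
      rw [abs_le]; constructor <;> linarith
    · refine (alpha_pow_bd 2 (by norm_num) h0 h2 (B := 8 * v) ?_).trans (by linarith)
      rw [abs_le]; constructor <;> linarith
    · refine (alpha_pow_bd 3 (by norm_num) h0 h2 (B := 8 * v) ?_).trans (by linarith)
      rw [abs_le]; constructor <;> linarith

lemma eul_E {α s : ℝ} (h0 : 0 ≤ α) (h2 : α ≤ 2) (hs : 0 ≤ s) :
    Eul (fun u => (s * u ^ α) ^ 2) 64 (fun u => Real.exp (-(s * u ^ α)) - 1 + s * u ^ α) := by
  refine ⟨fun u => α ^ 1 * (s * u ^ α - s * u ^ α * Real.exp (-(s * u ^ α))),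
    fun u => α ^ 2 * (s * u ^ α - (s * u ^ α - (s * u ^ α) ^ 2) * Real.exp (-(s * u ^ α))),
    fun u => α ^ 3 * (s * u ^ α -
      (s * u ^ α - 3 * (s * u ^ α) ^ 2 + (s * u ^ α) ^ 3) * Real.exp (-(s * u ^ α))),
    fun u hu => ?_⟩
  have hd := hasDeriv_v (α := α) (s := s) hu
  have he := hasDeriv_ev (α := α) (s := s) hu
  have hv : 0 ≤ s * u ^ α := by positivity
  refine ⟨⟨?_, ?_, ?_⟩, ?_⟩
  · refine ((he.sub_const 1).add hd).congr_deriv ?_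
    ring
  · refine ((hd.sub (hd.mul he)).const_mul _).congr_deriv ?_
    ring
  · refine ((hd.sub ((hd.sub (hd.pow 2)).mul he)).const_mul _).congr_deriv ?_
    simp only [Pi.sub_apply, Pi.pow_apply]
    push_cast
    ring
  · beta_reduce
    generalize s * u ^ α = v at hv ⊢
    obtain ⟨p, f0, f1, f2, f3, f4⟩ := exp_facts hv
    have g1 : 0 ≤ v - v * Real.exp (-v) := by nlinarith
    have g1' : v - v * Real.exp (-v) ≤ v ^ 2 := by nlinarith
    have g2 : 0 ≤ v ^ 2 * Real.exp (-v) := by positivity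
    have g2' : v ^ 2 * Real.exp (-v) ≤ v ^ 2 := by nlinarith
    have g3 : 0 ≤ v ^ 3 * Real.exp (-v) := by positivity
    have g3' : v ^ 3 * Real.exp (-v) ≤ v ^ 2 := by nlinarith [sq_nonneg v]
    refine ⟨?_, ?_, ?_, ?_⟩
    · rw [abs_le]; constructor <;> linarith
    · refine (alpha_pow_bd 1 (by norm_num) h0 h2 (B := 8 * v ^ 2) ?_).trans (by linarith)
      rw [abs_le]; constructor <;> linarith
    · refine (alpha_pow_bd 2 (by norm_num) h0 h2 (B := 8 * v ^ 2) ?_).trans (by linarith)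
      rw [abs_le]; constructor <;> linarith
    · refine (alpha_pow_bd 3 (by norm_num) h0 h2 (B := 8 * v ^ 2) ?_).trans (by linarith)
      rw [abs_le]; constructor <;> linarith

lemma one_le_log_inv {w : ℝ} (hw : 0 < w) (hw3 : w ≤ 1 / 3) : 1 ≤ Real.log (1 / w) := by
  rw [Real.le_log_iff_exp_le (by positivity)]
  have h := Real.exp_one_lt_d9
  have : 3 ≤ 1 / w := by rw [le_div_iff₀ hw]; linarith
  linarith

lemma eul_log {w : ℝ} (hw : 0 < w) (hw3 : w ≤ 1 / 3) :
    Eul (fun u => Real.log (1 / w) * (1 + |Real.log u|)) 1 (fun u => Real.log u + Real.log w) := by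
  have hL := one_le_log_inv hw hw3
  refine ⟨fun u => 1, fun u => 0, fun u => 0, fun u hu => ?_⟩
  have hb : (1:ℝ) ≤ Real.log (1 / w) * (1 + |Real.log u|) := by nlinarith [abs_nonneg (Real.log u)]
  refine ⟨⟨?_, ?_, ?_⟩, ?_, ?_, ?_, ?_⟩
  · exact ((Real.hasDerivAt_log hu.ne').add_const _).congr_deriv (by simp)
  · simpa using hasDerivAt_const u (1:ℝ)
  · simpa using hasDerivAt_const u (0:ℝ)
  · have e : Real.log (1 / w) = - Real.log w := by rw [one_div, Real.log_inv]
    rw [e] at hL hb ⊢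
    have : |Real.log u + Real.log w| ≤ |Real.log u| + (-Real.log w) := by
      refine (abs_add_le _ _).trans ?_
      rw [abs_of_nonpos (by linarith : Real.log w ≤ 0)]
    beta_reduce
    nlinarith [abs_nonneg (Real.log u)]
  · simpa using hb
  · rw [abs_zero]; linarith
  · rw [abs_zero]; linarith

lemma eul_sq : Eul (fun u => u ^ 2) 8 (fun u => u ^ 2) := by
  refine ⟨fun u => 2 * u ^ 2, fun u => 4 * u ^ 2, fun u => 8 * u ^ 2, fun u hu => ?_⟩
  have hd : HasDerivAt (fun u : ℝ => u ^ 2) (2 * u) u := by simpa using hasDerivAt_pow 2 u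
  have h2 : 0 ≤ u ^ 2 := by positivity
  refine ⟨⟨?_, ?_, ?_⟩, ?_, ?_, ?_, ?_⟩
  · exact hd.congr_deriv (by field_simp)
  · exact (hd.const_mul 2).congr_deriv (by field_simp; try ring)
  · exact (hd.const_mul 4).congr_deriv (by field_simp; try ring)
  all_goals (rw [abs_of_nonneg (by positivity)]; try linarith)

lemma rpow_le_exp {α u : ℝ} (h0 : 0 ≤ α) (h2 : α ≤ 2) (hu : 0 < u) :
    u ^ α ≤ 3 * Real.exp u := by
  have e0 : 1 ≤ Real.exp u := Real.one_le_exp hu.le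
  have e2 := pow_le_exp hu.le 2
  norm_num [Nat.factorial] at e2
  rcases le_total u 1 with h | h
  · have := Real.rpow_le_one hu.le h h0
    linarith
  · have := Real.rpow_le_rpow_of_exponent_le h h2
    rw [Real.rpow_two] at this
    linarith

lemma exp_six (u : ℝ) : Real.exp (-(6 * u)) * Real.exp u ^ 5 = Real.exp (-u) := by
  rw [← Real.exp_nat_mul, ← Real.exp_add]; congr 1; push_cast; ring

lemma exp_absorb {u X C : ℝ} (hu : 0 < u) (hC : 0 ≤ C) (hX : X ≤ C * Real.exp u ^ 2) :
    Real.exp (-(6 * u)) * X ≤ C * Real.exp (-u) := by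
  rw [← exp_six u]
  have e0 : 1 ≤ Real.exp u := Real.one_le_exp hu.le
  have h1 : Real.exp u ^ 2 ≤ Real.exp u ^ 5 := pow_le_pow_right₀ e0 (by norm_num)
  calc _ ≤ Real.exp (-(6 * u)) * (C * Real.exp u ^ 5) := by
        refine mul_le_mul_of_nonneg_left ?_ (Real.exp_pos _).le
        exact hX.trans (mul_le_mul_of_nonneg_left h1 hC)
    _ = _ := by ring

lemma rem_f : ∃ M > 0, ∀ α s : ℝ, 0 ≤ α → α ≤ 2 → 0 ≤ s →
    Eul (fun u => u ^ α * Real.exp (-u)) (M * s ^ 2) (fun u => Real.exp (-(u ^ 2) / 2) *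
      (Real.exp (-(s * u ^ α)) - 1 + s * u ^ α)) := by
  obtain ⟨M, hM, h⟩ := eul_gauss
  refine ⟨8 * (M * 64) * 3, by positivity, fun α s h0 h2 hs => ?_⟩
  refine (h.mul (eul_E h0 h2 hs)).mono fun u hu => ?_
  have e0 : 1 ≤ Real.exp u := Real.one_le_exp hu.le
  have := exp_absorb (X := u ^ α) (C := 3) hu (by norm_num) (by nlinarith [rpow_le_exp h0 h2 hu])
  calc _ = 8 * (M * 64) * s ^ 2 * u ^ α * (Real.exp (-(6 * u)) * u ^ α) := by ring
    _ ≤ 8 * (M * 64) * s ^ 2 * u ^ α * (3 * Real.exp (-u)) := by gcongr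
    _ = _ := by ring

lemma rem_g : ∃ M > 0, ∀ α s : ℝ, 0 ≤ α → α ≤ 2 → 0 ≤ s →
    Eul (fun u => u ^ α * Real.exp (-u)) (M * s) (fun u => Real.exp (-(u ^ 2) / 2) *
      (u ^ 2 * (1 - Real.exp (-(s * u ^ α))))) := by
  obtain ⟨M, hM, h⟩ := eul_gauss
  refine ⟨8 * (M * (8 * (8 * 64))) * 2, by positivity, fun α s h0 h2 hs => ?_⟩
  refine (h.mul (eul_sq.mul (eul_one_sub h0 h2 hs))).mono fun u hu => ?_
  have e0 : 1 ≤ Real.exp u := Real.one_le_exp hu.le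
  have e2 := pow_le_exp hu.le 2
  norm_num [Nat.factorial] at e2
  have := exp_absorb (X := u ^ 2) (C := 2) hu (by norm_num) (by nlinarith)
  calc _ = 8 * (M * (8 * (8 * 64))) * s * u ^ α * (Real.exp (-(6 * u)) * u ^ 2) := by ring
    _ ≤ 8 * (M * (8 * (8 * 64))) * s * u ^ α * (2 * Real.exp (-u)) := by gcongr
    _ = _ := by ring

lemma rem_h : ∃ M > 0, ∀ α s : ℝ, 0 ≤ α → α ≤ 2 → 0 ≤ s →
    Eul (fun u => u ^ α * Real.exp (-u)) (M * s ^ 2) (fun u => Real.exp (-(u ^ 2) / 2) *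
      (s * u ^ α * (1 - Real.exp (-(s * u ^ α))))) := by
  obtain ⟨M, hM, h⟩ := eul_gauss
  refine ⟨8 * (M * (8 * (8 * 64))) * 3, by positivity, fun α s h0 h2 hs => ?_⟩
  refine (h.mul ((eul_v h0 h2 hs).mul (eul_one_sub h0 h2 hs))).mono fun u hu => ?_
  have e0 : 1 ≤ Real.exp u := Real.one_le_exp hu.le
  have := exp_absorb (X := u ^ α) (C := 3) hu (by norm_num) (by nlinarith [rpow_le_exp h0 h2 hu])
  calc _ = 8 * (M * (8 * (8 * 64))) * s ^ 2 * u ^ α * (Real.exp (-(6 * u)) * u ^ α) := by ring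
    _ ≤ 8 * (M * (8 * (8 * 64))) * s ^ 2 * u ^ α * (3 * Real.exp (-u)) := by gcongr
    _ = _ := by ring

lemma rem_k {a : ℝ} (ha : 0 < a) : ∃ M > 0, ∀ α s w : ℝ, a ≤ α → α ≤ 2 → 0 ≤ s → 0 < w → w ≤ 1 / 3 →
    Eul (fun u => u ^ α * Real.exp (-u)) (M * (s ^ 2 * Real.log (1 / w)))
      (fun u => Real.exp (-(u ^ 2) / 2) *
      ((s * u ^ α * (1 - Real.exp (-(s * u ^ α)))) * (Real.log u + Real.log w))) := by
  obtain ⟨M, hM, h⟩ := eul_gauss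
  refine ⟨8 * (M * (8 * (8 * (8 * 64) * 1))) * (6 + 1 / a), by positivity,
    fun α s w h0 h2 hs hw hw3 => ?_⟩
  have h0' : 0 ≤ α := ha.le.trans h0
  have hL := one_le_log_inv hw hw3
  refine (h.mul (((eul_v h0' h2 hs).mul (eul_one_sub h0' h2 hs)).mul (eul_log hw hw3))).mono
    fun u hu => ?_
  have e0 : 1 ≤ Real.exp u := Real.one_le_exp hu.le
  have e1 := pow_le_exp hu.le 1
  norm_num [Nat.factorial] at e1
  have hr := rpow_le_exp h0' h2 hu
  have hb := rpow_log_bound ha h0 hu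
  have := exp_absorb (X := u ^ α * (1 + |Real.log u|)) (C := 6 + 1 / a) hu (by positivity) (by
    have h1 : u ^ α * u ≤ 3 * Real.exp u * Real.exp u := by gcongr
    have h2 : 1 / a ≤ 1 / a * Real.exp u ^ 2 :=
      le_mul_of_one_le_right (by positivity) (one_le_pow₀ e0)
    nlinarith)
  calc _ = 8 * (M * (8 * (8 * (8 * 64) * 1))) * (s ^ 2 * Real.log (1 / w)) * u ^ α
          * (Real.exp (-(6 * u)) * (u ^ α * (1 + |Real.log u|))) := by ring
    _ ≤ 8 * (M * (8 * (8 * (8 * 64) * 1))) * (s ^ 2 * Real.log (1 / w)) * u ^ α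
          * ((6 + 1 / a) * Real.exp (-u)) := by gcongr
    _ = _ := by ring

lemma decay_psi {a b : ℝ} (ha : 0 < a) (hb : b < 2) (ψ : ℝ → ℕ → ℝ → ℝ) (hψ : IsPsiFamily ψ) :
    ∃ C > 0, ∀ α, a ≤ α → α ≤ b → ∀ M F, Eul (fun u => u ^ α * Real.exp (-u)) M F →
      ∀ y, |∫ u in Ioi 0, Real.cos (y * u) * F u| ≤ C * M * ψ α 0 y := by
  obtain ⟨c, hc, C0, hcC⟩ := hψ.unifBound (Icc a b) (fun x hx => ⟨ha.trans_le hx.1, hx.2.trans_lt hb⟩)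
    isCompact_Icc 0
  refine ⟨3 + 3 / c + (5 + 6 / (2 - b)), ?_, fun α h1 h2 M F hF y => ?_⟩
  · have : 0 < 2 - b := by linarith
    positivity
  have hM : 0 ≤ M := by
    have := (abs_nonneg _).trans (hF.bound 1 one_pos)
    simp at this
    have h2 := Real.exp_pos (-1)
    by_contra hneg
    push Not at hneg
    nlinarith
  have hα : 0 < α := ha.trans_le h1
  have hα2 : α < 2 := h2.trans_lt hb
  have h2b : 0 < 2 - b := by linarith
  have hmem : α ∈ Ioo (0:ℝ) 2 := ⟨hα, hα2⟩
  have hy : |∫ u in Ioi 0, Real.cos (y * u) * F u| = |∫ u in Ioi 0, Real.cos (|y| * u) * F u| := by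
    congr 2
    funext u
    rcases abs_choice y with h | h <;> simp [h]
  have hψ0 := (hψ.pos α hmem 0 y).le
  have hd := decay_bdd hα hα2 hF y
  have q1 : 0 ≤ 6 / (2 - b) := by positivity
  have q2 : 0 ≤ 3 / c := by positivity
  have hMψ : 0 ≤ M * ψ α 0 y := by positivity
  rcases le_total (|y|) 1 with h | h
  · rw [hψ.eq_one α hmem 0 y h] at hMψ ⊢
    nlinarith
  rcases le_total (|y|) 3 with h' | h'
  · have h3 := (hcC α ⟨h1, h2⟩ y h h').1
    have : 3 * M ≤ 3 / c * (M * ψ α 0 y) := by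
      rw [div_mul_eq_mul_div, le_div_iff₀ hc]; nlinarith
    nlinarith
  · have h4 := decay_tail hα h2 hb hF h
    rw [hy]
    have h5 : (|y|)⁻¹ ^ (α + 1) = ψ α 0 y := by
      rw [hψ.eq_tail α hmem 0 y h', Real.inv_rpow (abs_nonneg _)]; simp
    rw [h5] at h4
    nlinarith



def dom (a b x : ℝ) : ℝ := (1 + 2 / a + 2 / (2 - b)) * (x ^ (-1 - a / 2) + x ^ (-1 - (1 + b / 2)))

def ker (α : ℝ) (l : ℕ) (x : ℝ) : ℝ := Real.log x ^ l * x ^ (-1 - α)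

lemma log_pow_bd {l : ℕ} (hl : l ≤ 1) (x : ℝ) : |Real.log x ^ l| ≤ 1 + |Real.log x| := by
  interval_cases l
  · simp
  · simp

lemma dom_bound {a b α x : ℝ} (ha : 0 < a) (hb : b < 2) (h1 : a ≤ α) (h2 : α ≤ b) (hx : 0 < x) :
    (1 + |Real.log x|) * x ^ (-1 - α) ≤ dom a b x := by
  have h2b : 0 < 2 - b := by linarith
  have p1 : 0 < x ^ (-1 - a / 2) := Real.rpow_pos_of_pos hx _
  have p2 : 0 < x ^ (-1 - (1 + b / 2)) := Real.rpow_pos_of_pos hx _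
  have q1 : 0 < 2 / a := by positivity
  have q2 : 0 < 2 / (2 - b) := by positivity
  unfold dom
  rcases le_total 1 x with h | h
  · have hl : |Real.log x| ≤ x ^ (a / 2) / (a / 2) := by
      rw [abs_of_nonneg (Real.log_nonneg h)]
      exact Real.log_le_rpow_div hx.le (by positivity)
    have h1' : 1 ≤ x ^ (a / 2) := Real.one_le_rpow h (by positivity)
    have h3 : x ^ (-1 - α) ≤ x ^ (-1 - a) := Real.rpow_le_rpow_of_exponent_le h (by linarith)
    have h4 : x ^ (a / 2) * x ^ (-1 - a) = x ^ (-1 - a / 2) := by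
      rw [← Real.rpow_add hx]; congr 1; ring
    calc _ ≤ (x ^ (a / 2) + x ^ (a / 2) / (a / 2)) * x ^ (-1 - a) := by gcongr
      _ = (1 + 2 / a) * (x ^ (a / 2) * x ^ (-1 - a)) := by field_simp
      _ = (1 + 2 / a) * x ^ (-1 - a / 2) := by rw [h4]
      _ ≤ _ := by nlinarith [mul_pos q1 p2, mul_pos q2 p1, mul_pos q2 p2]
  · have hx1 : 1 ≤ x⁻¹ := (one_le_inv₀ hx).2 h
    have hl : |Real.log x| ≤ x⁻¹ ^ ((2 - b) / 2) / ((2 - b) / 2) := by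
      rw [abs_of_nonpos (Real.log_nonpos hx.le h), ← Real.log_inv]
      exact Real.log_le_rpow_div (by positivity) (by positivity)
    have h1' : 1 ≤ x⁻¹ ^ ((2 - b) / 2) := Real.one_le_rpow hx1 (by positivity)
    have h3 : x ^ (-1 - α) ≤ x ^ (-1 - b) :=
      Real.rpow_le_rpow_of_exponent_ge hx h (by linarith)
    have h4 : x⁻¹ ^ ((2 - b) / 2) * x ^ (-1 - b) = x ^ (-1 - (1 + b / 2)) := by
      rw [Real.inv_rpow hx.le, ← Real.rpow_neg hx.le, ← Real.rpow_add hx]; congr 1; ring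
    calc _ ≤ (x⁻¹ ^ ((2 - b) / 2) + x⁻¹ ^ ((2 - b) / 2) / ((2 - b) / 2)) * x ^ (-1 - b) := by gcongr
      _ = (1 + 2 / (2 - b)) * (x⁻¹ ^ ((2 - b) / 2) * x ^ (-1 - b)) := by field_simp
      _ = (1 + 2 / (2 - b)) * x ^ (-1 - (1 + b / 2)) := by rw [h4]
      _ ≤ _ := by nlinarith [mul_pos q1 p2, mul_pos q2 p1, mul_pos q1 p1]

lemma ker_bd {a b α x : ℝ} {l : ℕ} (hl : l ≤ 1) (ha : 0 < a) (hb : b < 2) (h1 : a ≤ α) (h2 : α ≤ b)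
    (hx : 0 < x) : |ker α l x| ≤ dom a b x := by
  refine le_trans ?_ (dom_bound ha hb h1 h2 hx)
  unfold ker
  rw [abs_mul, abs_of_pos (Real.rpow_pos_of_pos hx _)]
  exact mul_le_mul_of_nonneg_right (log_pow_bd hl x) (Real.rpow_pos_of_pos hx _).le

lemma dom_nonneg {a b x : ℝ} (ha : 0 < a) (hb : b < 2) (hx : 0 < x) : 0 ≤ dom a b x := by
  have h2b : 0 < 2 - b := by linarith
  unfold dom; positivity

lemma min_rpow_int {p : ℝ} (h0 : 0 < p) (h2 : p < 2) :
    IntegrableOn (fun x : ℝ => min 1 (x ^ 2) * x ^ (-1 - p)) (Ioi 0) := by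
  have hm : Measurable (fun x : ℝ => min 1 (x ^ 2) * x ^ (-1 - p)) := by fun_prop
  rw [← Ioc_union_Ioi_eq_Ioi (zero_le_one (α := ℝ))]
  refine IntegrableOn.union ?_ ?_
  · have := (intervalIntegral.integrableOn_Ioo_rpow_iff (s := 1 - p) (t := (1:ℝ)) one_pos).2 (by linarith)
    rw [← integrableOn_Ioc_iff_integrableOn_Ioo] at this
    refine Integrable.mono' this hm.aestronglyMeasurable ?_
    refine (ae_restrict_iff' measurableSet_Ioc).2 (Eventually.of_forall fun x hx => ?_)
    have hx0 : 0 < x := hx.1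
    rw [Real.norm_of_nonneg (by positivity)]
    have : x ^ (1 - p) = x ^ 2 * x ^ (-1 - p) := by
      rw [← Real.rpow_two, ← Real.rpow_add hx0]; congr 1; ring
    rw [this]
    exact mul_le_mul_of_nonneg_right (min_le_right _ _) (by positivity)
  · have := integrableOn_Ioi_rpow_of_lt (a := -1 - p) (by linarith) (zero_lt_one (α := ℝ))
    refine Integrable.mono' this hm.aestronglyMeasurable ?_
    refine (ae_restrict_iff' measurableSet_Ioi).2 (Eventually.of_forall fun x hx => ?_)
    have hx0 : 0 < x := one_pos.trans hx
    rw [Real.norm_of_nonneg (by positivity)]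
    exact mul_le_of_le_one_left (by positivity) (min_le_left _ _)

lemma dom_int {a b : ℝ} (ha : 0 < a) (hab : a ≤ b) (hb : b < 2) :
    IntegrableOn (fun x : ℝ => min 1 (x ^ 2) * dom a b x) (Ioi 0) := by
  have h := ((min_rpow_int (p := a / 2) (by positivity) (by linarith)).add
    (min_rpow_int (p := 1 + b / 2) (by linarith) (by linarith))).const_mul (1 + 2 / a + 2 / (2 - b))
  refine h.congr (Eventually.of_forall fun x => ?_)
  simp only [dom, Pi.add_apply]; ring

lemma one_sub_cos_bd (u x : ℝ) : |1 - Real.cos (u * x)| ≤ (2 + u ^ 2) * min 1 (x ^ 2) := by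
  have h1 := Real.cos_le_one (u * x)
  have h2 := Real.neg_one_le_cos (u * x)
  have h3 := Real.one_sub_sq_div_two_le_cos (x := u * x)
  rw [abs_of_nonneg (by linarith)]
  rcases le_total 1 (x ^ 2) with h | h
  · rw [min_eq_left h]; nlinarith [sq_nonneg u]
  · rw [min_eq_right h]; nlinarith [sq_nonneg x, sq_nonneg (u * x)]

lemma ker_meas (α : ℝ) (l : ℕ) : Measurable (ker α l) := by unfold ker; fun_prop

lemma osc_int {α : ℝ} {l : ℕ} (hl : l ≤ 1) (h0 : 0 < α) (h2 : α < 2) (u : ℝ) :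
    IntegrableOn (fun x => (1 - Real.cos (u * x)) * ker α l x) (Ioi 0) := by
  have hk := ker_meas α l
  refine Integrable.mono' ((dom_int h0 le_rfl h2).const_mul (2 + u ^ 2))
    (by fun_prop) ?_
  refine (ae_restrict_iff' measurableSet_Ioi).2 (Eventually.of_forall fun x (hx : 0 < x) => ?_)
  rw [norm_mul, Real.norm_eq_abs, Real.norm_eq_abs, ← mul_assoc]
  exact mul_le_mul (one_sub_cos_bd u x) (ker_bd hl h0 h2 le_rfl le_rfl hx) (abs_nonneg _) (by positivity)

def Aint (α : ℝ) (l : ℕ) : ℝ := ∫ x in Ioi 0, (1 - Real.cos x) * ker α l x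

lemma scale0 {α u : ℝ} (hu : 0 < u) :
    ∫ x in Ioi 0, (1 - Real.cos (u * x)) * ker α 0 x = u ^ α * Aint α 0 := by
  have h := integral_comp_mul_left_Ioi (fun v => (1 - Real.cos v) * ker α 0 v) 0 hu
  simp only [mul_zero, smul_eq_mul] at h
  have e : ∫ x in Ioi 0, (1 - Real.cos (u * x)) * ker α 0 x
      = u ^ (1 + α) * ∫ x in Ioi 0, (1 - Real.cos (u * x)) * ker α 0 (u * x) := by
    rw [← integral_const_mul]
    refine setIntegral_congr_fun measurableSet_Ioi fun x (hx : 0 < x) => ?_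
    have : u ^ (1 + α) * u ^ (-1 - α) = 1 := by
      rw [← Real.rpow_add hu]; simp
    simp only [ker, pow_zero, one_mul]
    rw [Real.mul_rpow hu.le hx.le]
    linear_combination (-(1 - Real.cos (u * x)) * x ^ (-1 - α)) * this
  rw [e, h, Aint, Real.rpow_add hu, Real.rpow_one]
  field_simp

lemma scale1 {α u : ℝ} (h0 : 0 < α) (h2 : α < 2) (hu : 0 < u) :
    ∫ x in Ioi 0, (1 - Real.cos (u * x)) * ker α 1 x
      = u ^ α * (Aint α 1 - Real.log u * Aint α 0) := by
  have h := integral_comp_mul_left_Ioi (fun v => (1 - Real.cos v) * ker α 1 v) 0 hu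
  simp only [mul_zero, smul_eq_mul] at h
  have e : ∫ x in Ioi 0, (1 - Real.cos (u * x)) * ker α 1 (u * x)
      = u ^ (-1 - α) * ∫ x in Ioi 0, (Real.log u * ((1 - Real.cos (u * x)) * ker α 0 x)
        + (1 - Real.cos (u * x)) * ker α 1 x) := by
    rw [← integral_const_mul]
    refine setIntegral_congr_fun measurableSet_Ioi fun x (hx : 0 < x) => ?_
    simp only [ker, pow_zero, one_mul, pow_one]
    rw [Real.mul_rpow hu.le hx.le, Real.log_mul hu.ne' hx.ne']
    ring
  rw [integral_add ((osc_int (by norm_num) h0 h2 u).const_mul _) (osc_int le_rfl h0 h2 u),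
    integral_const_mul, scale0 hu] at e
  rw [e] at h
  have h3 : u ^ (-1 - α) = u⁻¹ * (u ^ α)⁻¹ := by
    rw [Real.rpow_sub hu, Real.rpow_neg_one]; rfl
  rw [h3] at h
  have hp : 0 < u ^ α := Real.rpow_pos_of_pos hu _
  change _ = u⁻¹ * Aint α 1 at h
  field_simp at h
  linear_combination h



def Tint (α : ℝ) (l : ℕ) (y : ℝ) : ℝ :=
  ∫ x in Ioi 0, (2 * gauss y - gauss (y - x) - gauss (y + x)) * ker α l x

def Vint (α : ℝ) (l : ℕ) (y : ℝ) : ℝ :=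
  Real.pi⁻¹ * ∫ u in Ioi 0, Real.cos (y * u) * (Real.exp (-(u ^ 2) / 2) * (u ^ α * Real.log u ^ l))

lemma rpow_gauss_int {q : ℝ} (hq : -1 < q) :
    IntegrableOn (fun u : ℝ => Real.exp (-(u ^ 2) / 2) * u ^ q) (Ioi 0) := by
  refine (integrableOn_rpow_mul_exp_neg_mul_sq (b := 1 / 2) (by norm_num) hq).congr_fun
    (fun u hu => ?_) measurableSet_Ioi
  simp only
  rw [mul_comm]; congr 2; ring

lemma cosg_int (y : ℝ) : IntegrableOn (fun u : ℝ => Real.cos (y * u) * Real.exp (-(u ^ 2) / 2)) (Ioi 0) := by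
  have h := rpow_gauss_int (q := 0) (by norm_num)
  refine Integrable.mono' h (by fun_prop) (Eventually.of_forall fun u => ?_)
  rw [norm_mul, Real.norm_eq_abs, Real.norm_eq_abs, Real.abs_exp]
  have := Real.abs_cos_le_one (y * u)
  simp only [Real.rpow_zero, mul_one]
  exact mul_le_of_le_one_left (Real.exp_pos _).le this

lemma Vint_int {α : ℝ} {l : ℕ} (hl : l ≤ 1) (h0 : 0 < α) (y : ℝ) :
    IntegrableOn (fun u : ℝ => Real.cos (y * u) * (Real.exp (-(u ^ 2) / 2) * (u ^ α * Real.log u ^ l)))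
      (Ioi 0) := by
  have h := ((rpow_gauss_int (q := 0) (by norm_num)).const_mul (1 / α)).add
    ((rpow_gauss_int (q := α) (by linarith)).add (rpow_gauss_int (q := α + 1) (by linarith)))
  refine Integrable.mono' h (by fun_prop) ?_
  refine (ae_restrict_iff' measurableSet_Ioi).2 (Eventually.of_forall fun u (hu : 0 < u) => ?_)
  rw [norm_mul, norm_mul, Real.norm_eq_abs, Real.norm_eq_abs, Real.norm_eq_abs, Real.abs_exp]
  have h1 := Real.abs_cos_le_one (y * u)
  have h2 : |u ^ α * Real.log u ^ l| ≤ 1 / α + u ^ α + u ^ α * u := by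
    rw [abs_mul, abs_of_pos (Real.rpow_pos_of_pos hu _)]
    have := rpow_log_bound h0 le_rfl hu
    have h3 := mul_le_mul_of_nonneg_left (log_pow_bd hl u) (Real.rpow_pos_of_pos hu α).le
    linarith
  simp only [Pi.add_apply, Real.rpow_zero, mul_one, Real.rpow_add_one hu.ne']
  calc _ ≤ 1 * (Real.exp (-(u ^ 2) / 2) * (1 / α + u ^ α + u ^ α * u)) := by gcongr
    _ = _ := by ring

lemma inner_gauss (y x : ℝ) :
    Real.pi⁻¹ * ∫ u in Ioi 0, Real.cos (y * u) * Real.exp (-(u ^ 2) / 2) * (1 - Real.cos (u * x))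
      = (2 * gauss y - gauss (y - x) - gauss (y + x)) / 2 := by
  have e : ∀ u : ℝ, Real.cos (y * u) * Real.exp (-(u ^ 2) / 2) * (1 - Real.cos (u * x))
      = Real.cos (y * u) * Real.exp (-(u ^ 2) / 2) - (2⁻¹ * (Real.cos ((y - x) * u) * Real.exp (-(u ^ 2) / 2))
        + 2⁻¹ * (Real.cos ((y + x) * u) * Real.exp (-(u ^ 2) / 2))) := by
    intro u
    have h1 : (y - x) * u = y * u - u * x := by ring
    have h2 : (y + x) * u = y * u + u * x := by ring
    rw [h1, h2, Real.cos_sub, Real.cos_add]; ring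
  simp_rw [e]
  have hadd : IntegrableOn (fun u : ℝ => 2⁻¹ * (Real.cos ((y - x) * u) * Real.exp (-(u ^ 2) / 2))
        + 2⁻¹ * (Real.cos ((y + x) * u) * Real.exp (-(u ^ 2) / 2))) (Ioi 0) :=
    ((cosg_int _).const_mul _).add ((cosg_int _).const_mul _)
  rw [integral_sub (cosg_int y) hadd,
    integral_add ((cosg_int _).const_mul _) ((cosg_int _).const_mul _),
    integral_const_mul, integral_const_mul, gauss_rep y, gauss_rep (y - x), gauss_rep (y + x)]
  ring

lemma fubini {α : ℝ} {l : ℕ} (hl : l ≤ 1) (h0 : 0 < α) (h2 : α < 2) (y : ℝ) :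
    Real.pi⁻¹ * ∫ u in Ioi 0, Real.cos (y * u) * Real.exp (-(u ^ 2) / 2) *
      (∫ x in Ioi 0, (1 - Real.cos (u * x)) * ker α l x) = Tint α l y / 2 := by
  have hk := ker_meas α l
  have hintg : Integrable (Function.uncurry fun u x : ℝ => Real.cos (y * u) * Real.exp (-(u ^ 2) / 2) *
      ((1 - Real.cos (u * x)) * ker α l x)) ((volume.restrict (Ioi 0)).prod (volume.restrict (Ioi 0))) := by
    have g1 : IntegrableOn (fun u : ℝ => Real.exp (-(u ^ 2) / 2) * (2 + u ^ 2)) (Ioi 0) := by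
      refine (((rpow_gauss_int (q := 0) (by norm_num)).const_mul 2).add
        (rpow_gauss_int (q := 2) (by norm_num))).congr (Eventually.of_forall fun u => ?_)
      simp only [Pi.add_apply, Real.rpow_zero, Real.rpow_two]; ring
    refine Integrable.mono' (g1.mul_prod (dom_int h0 le_rfl h2)) ?_ ?_
    · apply Measurable.aestronglyMeasurable
      unfold Function.uncurry
      fun_prop
    · rw [Measure.prod_restrict]
      refine (ae_restrict_iff' (measurableSet_Ioi.prod measurableSet_Ioi)).2
        (Eventually.of_forall fun p hp => ?_)
      obtain ⟨u, x⟩ := p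
      have hx : 0 < x := hp.2
      simp only [Function.uncurry_apply_pair, norm_mul, Real.norm_eq_abs, Real.abs_exp]
      have c1 := Real.abs_cos_le_one (y * u)
      have c2 := one_sub_cos_bd u x
      have c3 := ker_bd hl h0 h2 le_rfl le_rfl hx
      calc _ ≤ 1 * Real.exp (-(u ^ 2) / 2) * ((2 + u ^ 2) * min 1 (x ^ 2) * dom α α x) := by gcongr
        _ = _ := by ring
  have hs := integral_integral_swap hintg
  have e2 : ∀ u : ℝ, Real.cos (y * u) * Real.exp (-(u ^ 2) / 2) *
      (∫ x in Ioi 0, (1 - Real.cos (u * x)) * ker α l x) =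
      ∫ x in Ioi 0, Real.cos (y * u) * Real.exp (-(u ^ 2) / 2) * ((1 - Real.cos (u * x)) * ker α l x) :=
    fun u => (integral_const_mul _ _).symm
  simp_rw [e2]
  rw [hs, ← integral_const_mul, Tint, ← integral_div]
  congr 1
  funext x
  have := inner_gauss y x
  rw [mul_div_right_comm, ← this, mul_assoc, ← integral_mul_const]
  congr 2
  funext u
  ring

lemma V0_eq {α : ℝ} (h0 : 0 < α) (h2 : α < 2) (y : ℝ) :
    Aint α 0 * Vint α 0 y = Tint α 0 y / 2 := by
  rw [← fubini (by norm_num) h0 h2 y, Vint, ← mul_assoc, mul_comm (Aint α 0), mul_assoc, ← integral_const_mul]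
  congr 1
  refine setIntegral_congr_fun measurableSet_Ioi fun u (hu : 0 < u) => ?_
  simp only [scale0 hu, pow_zero]
  ring

lemma V1_eq {α : ℝ} (h0 : 0 < α) (h2 : α < 2) (y : ℝ) :
    Aint α 1 * Vint α 0 y - Aint α 0 * Vint α 1 y = Tint α 1 y / 2 := by
  rw [← fubini le_rfl h0 h2 y, Vint, Vint, ← mul_assoc, ← mul_assoc, mul_comm (Aint α 0),
    mul_comm (Aint α 1), mul_assoc, mul_assoc, ← mul_sub, ← integral_const_mul, ← integral_const_mul,
    ← integral_sub ((Vint_int (by norm_num) h0 y).const_mul _) ((Vint_int le_rfl h0 y).const_mul _)]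
  congr 1
  refine setIntegral_congr_fun measurableSet_Ioi fun u (hu : 0 < u) => ?_
  simp only [scale1 h0 h2 hu, pow_zero, pow_one]
  ring



lemma J_val {q : ℝ} (hq : -1 < q) :
    ∫ u in Ioi 0, Real.exp (-(u ^ 2) / 2) * u ^ q = 2 ^ ((q - 1) / 2) * Real.Gamma ((q + 1) / 2) := by
  have h := integral_rpow_mul_exp_neg_mul_rpow (p := 2) (q := q) (b := 1 / 2) (by norm_num) hq (by norm_num)
  have e : ∫ u in Ioi 0, Real.exp (-(u ^ 2) / 2) * u ^ q
      = ∫ x in Ioi 0, x ^ q * Real.exp (-(1 / 2) * x ^ (2:ℝ)) := by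
    congr 1; funext u
    rw [mul_comm, Real.rpow_two]; congr 2; ring
  rw [e, h]
  congr 1
  rw [one_div, Real.inv_rpow (by norm_num), ← Real.rpow_neg (by norm_num), ← Real.rpow_neg_one 2,
    ← Real.rpow_add (by norm_num)]
  congr 1; ring

lemma ibp {α : ℝ} (h0 : 0 < α) (h2 : α < 2) :
    ∫ x in Ioi 0, (1 - Real.exp (-(x ^ 2) / 2)) * x ^ (-1 - α)
      = α⁻¹ * ∫ x in Ioi 0, Real.exp (-(x ^ 2) / 2) * x ^ (1 - α) := by
  have b0 : ∀ x : ℝ, 0 ≤ 1 - Real.exp (-(x ^ 2) / 2) := fun x => by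
    have : Real.exp (-(x ^ 2) / 2) ≤ 1 := Real.exp_le_one_iff.2 (by nlinarith [sq_nonneg x])
    linarith
  have b1 : ∀ x : ℝ, 1 - Real.exp (-(x ^ 2) / 2) ≤ 1 := fun x => by
    linarith [Real.exp_pos (-(x ^ 2) / 2)]
  have b2 : ∀ x : ℝ, 1 - Real.exp (-(x ^ 2) / 2) ≤ x ^ 2 := fun x => by
    nlinarith [Real.add_one_le_exp (-(x ^ 2) / 2), sq_nonneg x]
  have i1 : IntegrableOn (fun x : ℝ => (1 - Real.exp (-(x ^ 2) / 2)) * x ^ (-1 - α)) (Ioi 0) := by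
    refine Integrable.mono' (min_rpow_int h0 h2) (by fun_prop) ?_
    refine (ae_restrict_iff' measurableSet_Ioi).2 (Eventually.of_forall fun x (hx : 0 < x) => ?_)
    have hp := Real.rpow_pos_of_pos hx (-1 - α)
    rw [norm_mul, Real.norm_of_nonneg (b0 x), Real.norm_of_nonneg hp.le]
    exact mul_le_mul_of_nonneg_right (le_min (b1 x) (b2 x)) hp.le
  have i2 := rpow_gauss_int (q := 1 - α) (by linarith)
  have key := integral_Ioi_of_hasDerivAt_of_tendsto (a := 0) (m := 0)
    (f := fun x : ℝ => (1 - Real.exp (-(x ^ 2) / 2)) * x ^ (-α))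
    (f' := fun x : ℝ => Real.exp (-(x ^ 2) / 2) * x ^ (1 - α)
      - α * ((1 - Real.exp (-(x ^ 2) / 2)) * x ^ (-1 - α))) ?_ ?_ (i2.sub (i1.const_mul α)) ?_
  · rw [integral_sub i2 (i1.const_mul α), integral_const_mul] at key
    have hz : (1 - Real.exp (-((0:ℝ) ^ 2) / 2)) = 0 := by simp
    beta_reduce at key
    rw [hz, zero_mul, sub_zero, sub_eq_zero] at key
    rw [key]; field_simp
  · have hz : (fun x : ℝ => (1 - Real.exp (-(x ^ 2) / 2)) * x ^ (-α)) 0 = 0 := by simp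
    unfold ContinuousWithinAt
    rw [hz]
    have hlim : Tendsto (fun x : ℝ => x ^ (2 - α)) (𝓝[Ici 0] 0) (𝓝 0) := by
      have := (Real.continuous_rpow_const (q := 2 - α) (by linarith)).tendsto 0
      rw [Real.zero_rpow (by linarith)] at this
      exact this.mono_left nhdsWithin_le_nhds
    refine squeeze_zero' (g := fun x : ℝ => x ^ (2 - α)) ?_ ?_ hlim
    · filter_upwards [self_mem_nhdsWithin] with x hx
      exact mul_nonneg (b0 x) (Real.rpow_nonneg hx _)
    · filter_upwards [self_mem_nhdsWithin] with x (hx : 0 ≤ x)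
      rcases hx.eq_or_lt with rfl | hx
      · simp; exact Real.rpow_nonneg le_rfl _
      · rw [sub_eq_add_neg 2 α, Real.rpow_add hx, Real.rpow_two]
        exact mul_le_mul_of_nonneg_right (b2 x) (Real.rpow_nonneg hx.le _)
  · intro x (hx : 0 < x)
    have hE : HasDerivAt (fun u : ℝ => Real.exp (-(u ^ 2) / 2)) (-x * Real.exp (-(x ^ 2) / 2)) x := by
      have h : HasDerivAt (fun x : ℝ => -(x ^ 2) / 2) (-x) x := by
        have := ((hasDerivAt_pow 2 x).neg.div_const 2)
        exact this.congr_deriv (by simp; ring)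
      exact h.exp.congr_deriv (by ring)
    refine ((hE.const_sub 1).mul (Real.hasDerivAt_rpow_const (x := x) (p := -α) (Or.inl hx.ne'))).congr_deriv ?_
    have e1 : x ^ (1 - α) = x * x ^ (-α) := by
      rw [sub_eq_add_neg, Real.rpow_add hx, Real.rpow_one]
    have e2 : x ^ (-α - 1) = x ^ (-1 - α) := by congr 1; ring
    rw [e1, e2]; ring
  · refine squeeze_zero' (g := fun x : ℝ => x ^ (-α)) ?_ ?_ (tendsto_rpow_neg_atTop h0)
    · filter_upwards [eventually_ge_atTop 0] with x hx
      exact mul_nonneg (b0 x) (Real.rpow_nonneg hx _)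
    · filter_upwards [eventually_ge_atTop 0] with x hx
      exact mul_le_of_le_one_left (Real.rpow_nonneg hx _) (b1 x)

lemma A_val {α : ℝ} (h0 : 0 < α) (h2 : α < 2) :
    Aint α 0 = Real.pi / (2 * (Real.Gamma (α + 1) * Real.sin (Real.pi * α / 2))) := by
  have h := V0_eq h0 h2 0
  have hV : Vint α 0 0 = Real.pi⁻¹ * (2 ^ ((α - 1) / 2) * Real.Gamma ((α + 1) / 2)) := by
    rw [← J_val (by linarith), Vint]; simp
  have hT : Tint α 0 0 / 2 = (Real.sqrt (2 * Real.pi))⁻¹ *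
      (α⁻¹ * (2 ^ (-α / 2) * Real.Gamma (1 - α / 2))) := by
    have := J_val (q := 1 - α) (by linarith)
    rw [show (1 - α - 1) / 2 = -α / 2 by ring, show (1 - α + 1) / 2 = 1 - α / 2 by ring] at this
    rw [← this, ← ibp h0 h2, ← integral_const_mul, Tint, ← integral_div]
    congr 1; funext x
    simp only [ker, gauss, pow_zero, zero_sub, zero_add, neg_sq]
    norm_num
    ring
  rw [hV, hT] at h
  have hdup := Real.Gamma_mul_Gamma_add_half ((α + 1) / 2)
  have hrefl := Real.Gamma_mul_Gamma_one_sub (α / 2)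
  rw [show (α + 1) / 2 + 1 / 2 = α / 2 + 1 by ring, Real.Gamma_add_one (by positivity),
    show 2 * ((α + 1) / 2) = α + 1 by ring, show 1 - (α + 1) = -α by ring] at hdup
  rw [show Real.pi * (α / 2) = Real.pi * α / 2 by ring] at hrefl
  have hsin : 0 < Real.sin (Real.pi * α / 2) := by
    apply Real.sin_pos_of_pos_of_lt_pi
    · positivity
    · nlinarith [Real.pi_pos]
  have g1 : 0 < Real.Gamma ((α + 1) / 2) := Real.Gamma_pos_of_pos (by positivity)
  have g2 : 0 < Real.Gamma (α / 2) := Real.Gamma_pos_of_pos (by positivity)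
  have g3 : 0 < Real.Gamma (α + 1) := Real.Gamma_pos_of_pos (by positivity)
  have g4 : 0 < Real.Gamma (1 - α / 2) := Real.Gamma_pos_of_pos (by linarith)
  have hpi := Real.pi_pos
  have r1 : (2:ℝ) ^ ((α - 1) / 2) = 2 ^ (α / 2) * (Real.sqrt 2)⁻¹ := by
    rw [show (α - 1) / 2 = α / 2 - 1 / 2 by ring, Real.rpow_sub (by norm_num), Real.sqrt_eq_rpow]; rfl
  have r2 : (2:ℝ) ^ (-α / 2) = (2 ^ (α / 2))⁻¹ := by
    rw [show -α / 2 = -(α / 2) by ring, Real.rpow_neg (by norm_num)]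
  have r3 : (2:ℝ) ^ (-α) = (2 ^ (α / 2))⁻¹ * (2 ^ (α / 2))⁻¹ := by
    rw [← r2, ← Real.rpow_add (by norm_num)]; congr 1; ring
  have hP : (0:ℝ) < 2 ^ (α / 2) := by positivity
  rw [r1, r2, Real.sqrt_mul (by norm_num)] at h
  rw [r3] at hdup
  have hq2 : 0 < Real.sqrt 2 := by positivity
  have hqp : 0 < Real.sqrt Real.pi := by positivity
  have hqp2 : Real.sqrt Real.pi * Real.sqrt Real.pi = Real.pi := Real.mul_self_sqrt hpi.le
  generalize Real.sqrt 2 = r at *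
  generalize (2:ℝ) ^ (α / 2) = P at *
  generalize Real.Gamma ((α + 1) / 2) = G1 at *
  generalize Real.Gamma (α / 2) = G2 at *
  generalize Real.Gamma (α + 1) = G3 at *
  generalize Real.Gamma (1 - α / 2) = G4 at *
  generalize Real.sin (Real.pi * α / 2) = S at *
  generalize Real.sqrt Real.pi = R at *
  generalize Aint α 0 = A at *
  rw [← hqp2] at h hrefl ⊢
  clear hqp2 hV hT r1 r2 r3
  field_simp at h hdup hrefl ⊢
  -- h : relation for A
  have t1 : G3 = G1 * α * G2 * P ^ 2 / (2 * R) := by field_simp; linarith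
  have t2 : S = R ^ 2 / (G2 * G4) := by field_simp; linarith
  rw [t1, t2]
  field_simp
  linarith



lemma sin_half_pos {α : ℝ} (h0 : 0 < α) (h2 : α < 2) : 0 < Real.sin (Real.pi * α / 2) := by
  have := Real.pi_pos
  apply Real.sin_pos_of_pos_of_lt_pi
  · positivity
  · nlinarith

lemma c_val {α : ℝ} (h0 : 0 < α) (h2 : α < 2) :
    cAlpha α = Real.Gamma (α + 1) * Real.sin (Real.pi * α / 2) / Real.pi := by
  have hpi := Real.pi_pos
  have hsin := sin_half_pos h0 h2
  unfold cAlpha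
  split_ifs with h1
  · subst h1
    rw [Real.Gamma_add_one one_ne_zero, Real.Gamma_one, mul_one Real.pi, Real.sin_pi_div_two]
    ring
  · have hr := Real.Gamma_mul_Gamma_one_sub (α - 1)
    have hs : Real.sin (Real.pi * (α - 1)) =
        -(2 * Real.sin (Real.pi * α / 2) * Real.cos (Real.pi * α / 2)) := by
      rw [← Real.sin_two_mul, show Real.pi * (α - 1) = 2 * (Real.pi * α / 2) - Real.pi by ring,
        Real.sin_sub_pi]
    have hne : α - 1 ≠ 0 := sub_ne_zero.2 h1
    have hc : Real.cos (Real.pi * α / 2) ≠ 0 := by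
      intro h
      rw [Real.cos_eq_zero_iff] at h
      obtain ⟨k, hk⟩ := h
      have hk' : α = 2 * k + 1 := by
        field_simp at hk
        linarith
      have k1 : (k:ℝ) < 1 := by linarith
      have k0 : (-1:ℝ) < k := by linarith
      have : k = 0 := by
        have a1 : k < 1 := by exact_mod_cast k1
        have a2 : -1 < k := by exact_mod_cast k0
        omega
      rw [this] at hk'
      simp at hk'
      exact h1 hk'
    rw [hs, show 1 - (α - 1) = 2 - α by ring] at hr
    have g : 0 < Real.Gamma (2 - α) := Real.Gamma_pos_of_pos (by linarith)
    have e1 : Real.Gamma (α + 1) = α * ((α - 1) * Real.Gamma (α - 1)) := by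
      rw [Real.Gamma_add_one h0.ne', ← Real.Gamma_add_one hne, sub_add_cancel]
    rw [e1]
    have e2 : Real.Gamma (α - 1) = Real.pi / -(2 * Real.sin (Real.pi * α / 2) * Real.cos (Real.pi * α / 2))
        / Real.Gamma (2 - α) := by rw [← hr]; field_simp
    rw [e2]
    generalize Real.sin (Real.pi * α / 2) = S at *
    generalize Real.cos (Real.pi * α / 2) = Co at *
    field_simp

lemma cA {α : ℝ} (h0 : 0 < α) (h2 : α < 2) : 2 * cAlpha α * Aint α 0 = 1 := by
  have hpi := Real.pi_pos
  have hsin := sin_half_pos h0 h2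
  have g : 0 < Real.Gamma (α + 1) := Real.Gamma_pos_of_pos (by linarith)
  rw [c_val h0 h2, A_val h0 h2]
  generalize Real.sin (Real.pi * α / 2) = S at *
  field_simp

lemma A_deriv {α : ℝ} (h0 : 0 < α) (h2 : α < 2) :
    HasDerivAt (fun p => Aint p 0) (-Aint α 1) α := by
  have hs : Icc (α / 2) (1 + α / 2) ∈ 𝓝 α := Icc_mem_nhds (by linarith) (by linarith)
  have hm : ∀ p l, AEStronglyMeasurable (fun x => (1 - Real.cos x) * ker p l x) (volume.restrict (Ioi 0)) := by
    intro p l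
    have := ker_meas p l
    fun_prop
  have key := hasDerivAt_integral_of_dominated_loc_of_deriv_le (μ := volume.restrict (Ioi 0))
    (F := fun p x => (1 - Real.cos x) * ker p 0 x)
    (F' := fun p x => -((1 - Real.cos x) * ker p 1 x))
    (bound := fun x => 3 * (min 1 (x ^ 2) * dom (α / 2) (1 + α / 2) x)) (x₀ := α) hs
    (Eventually.of_forall fun p => hm p 0) (by simpa [IntegrableOn] using osc_int (l := 0) (by norm_num) h0 h2 1)
    (hm α 1).neg ?_ ((dom_int (by linarith) (by linarith) (by linarith)).const_mul 3) ?_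
  · have := key.2
    rw [integral_neg] at this
    exact this
  · refine (ae_restrict_iff' measurableSet_Ioi).2 (Eventually.of_forall fun x (hx : 0 < x) p hp => ?_)
    rw [norm_neg, norm_mul, Real.norm_eq_abs, Real.norm_eq_abs, ← mul_assoc]
    have := one_sub_cos_bd 1 x
    norm_num at this
    exact mul_le_mul this (ker_bd le_rfl (by linarith) (by linarith) hp.1 hp.2 hx) (abs_nonneg _)
      (by positivity)
  · refine (ae_restrict_iff' measurableSet_Ioi).2 (Eventually.of_forall fun x (hx : 0 < x) p hp => ?_)
    have hd : HasDerivAt (fun p : ℝ => -1 - p) (-1) p := by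
      simpa using (hasDerivAt_id p).const_sub (-1)
    refine ((hd.const_rpow hx).const_mul (1 - Real.cos x)).congr_deriv ?_ |>.congr_of_eventuallyEq ?_
    · simp only [ker]; ring
    · refine Eventually.of_forall fun q => ?_
      simp [ker]

lemma c_deriv {α : ℝ} (h0 : 0 < α) (h2 : α < 2) :
    deriv cAlpha α = 2 * cAlpha α ^ 2 * Aint α 1 := by
  have hc := cA h0 h2
  have hA : Aint α 0 ≠ 0 := by
    intro h; rw [h] at hc; simp at hc
  have e : cAlpha =ᶠ[𝓝 α] fun p => (2 * Aint p 0)⁻¹ := by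
    filter_upwards [Ioo_mem_nhds h0 h2] with p hp
    have := cA hp.1 hp.2
    exact eq_inv_of_mul_eq_one_left (by linarith)
  have hd := ((A_deriv h0 h2).const_mul 2).inv (by simpa using hA)
  rw [e.deriv_eq]
  have hd' : HasDerivAt (fun p => (2 * Aint p 0)⁻¹) (-(2 * -Aint α 1) / (2 * Aint α 0) ^ 2) α := hd
  rw [hd'.deriv]
  have : cAlpha α = (2 * Aint α 0)⁻¹ := eq_inv_of_mul_eq_one_left (by linarith)
  rw [this]
  field_simp

lemma V0_c {α : ℝ} (h0 : 0 < α) (h2 : α < 2) (y : ℝ) : Vint α 0 y = cAlpha α * Tint α 0 y := by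
  have h := V0_eq h0 h2 y
  have hc := cA h0 h2
  linear_combination (-Vint α 0 y) * hc + 2 * cAlpha α * h

lemma V1_c {α : ℝ} (h0 : 0 < α) (h2 : α < 2) (y : ℝ) :
    Vint α 1 y = deriv cAlpha α * Tint α 0 y - cAlpha α * Tint α 1 y := by
  have h := V1_eq h0 h2 y
  have hc := cA h0 h2
  have h3 := V0_c h0 h2 y
  rw [c_deriv h0 h2]
  linear_combination (-Vint α 1 y) * hc - 2 * cAlpha α * h + 2 * cAlpha α * Aint α 1 * h3

lemma c_bdd {a b : ℝ} (ha : 0 < a) (hab : a ≤ b) (hb : b < 2) : ∃ B > 0, ∀ α, a ≤ α → α ≤ b →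
    |cAlpha α| ≤ B ∧ |deriv cAlpha α| ≤ B := by
  have hcont : ContinuousOn (fun α : ℝ => Real.Gamma (α + 1) * Real.sin (Real.pi * α / 2) / Real.pi) (Icc a b) := by
    have : ContinuousOn (fun α : ℝ => Real.Gamma (α + 1)) (Icc a b) := by
      intro x hx
      have hx0 : 0 < x := ha.trans_le hx.1
      have h1 : ContinuousAt Real.Gamma (x + 1) := (Real.differentiableAt_Gamma (fun m => by
        have : (0:ℝ) ≤ m := m.cast_nonneg
        intro h; linarith)).continuousAt
      have h2 : ContinuousAt (fun α : ℝ => α + 1) x := by fun_prop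
      exact (ContinuousAt.comp (f := fun α : ℝ => α + 1) h1 h2).continuousWithinAt
    fun_prop
  obtain ⟨B, hB⟩ := isCompact_Icc.exists_bound_of_continuousOn hcont
  set I := ∫ x in Ioi 0, 3 * (min 1 (x ^ 2) * dom a b x) with hI
  have hA : ∀ α, a ≤ α → α ≤ b → |Aint α 1| ≤ I := by
    intro α h1 h2
    rw [← Real.norm_eq_abs, Aint]
    refine norm_integral_le_of_norm_le ((dom_int ha hab hb).const_mul 3) ?_
    refine (ae_restrict_iff' measurableSet_Ioi).2 (Eventually.of_forall fun x (hx : 0 < x) => ?_)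
    rw [norm_mul, Real.norm_eq_abs, Real.norm_eq_abs, ← mul_assoc]
    have := one_sub_cos_bd 1 x
    norm_num at this
    exact mul_le_mul this (ker_bd le_rfl ha hb h1 h2 hx) (abs_nonneg _) (by positivity)
  have hI0 : 0 ≤ I := (abs_nonneg _).trans (hA a le_rfl hab)
  have hB0 : 0 ≤ B := (norm_nonneg _).trans (hB a ⟨le_rfl, hab⟩)
  refine ⟨B + 2 * B ^ 2 * I + 1, by positivity, fun α h1 h2 => ?_⟩
  have p0 : 0 < α := ha.trans_le h1
  have p2 : α < 2 := h2.trans_lt hb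
  have hc : |cAlpha α| ≤ B := by
    rw [c_val p0 p2]; exact hB α ⟨h1, h2⟩
  refine ⟨by nlinarith [mul_nonneg (sq_nonneg B) hI0], ?_⟩
  rw [c_deriv p0 p2, abs_mul, abs_mul, abs_pow, abs_two]
  calc _ ≤ 2 * B ^ 2 * I := by
        have := hA α h1 h2
        gcongr
    _ ≤ _ := by linarith



lemma gauss_le {C y z : ℝ} (h : -(y ^ 2) / 2 ≤ C + -(z ^ 2) / 2) : gauss y ≤ Real.exp C * gauss z := by
  unfold gauss
  have : Real.exp (-(y ^ 2) / 2) ≤ Real.exp C * Real.exp (-(z ^ 2) / 2) := by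
    rw [← Real.exp_add]; exact Real.exp_le_exp.2 h
  calc _ ≤ (Real.sqrt (2 * Real.pi))⁻¹ * (Real.exp C * Real.exp (-(z ^ 2) / 2)) := by gcongr
    _ = _ := by ring

lemma gauss_half (y : ℝ) : gauss y ≤ gauss (y / 2) := by
  have := gauss_le (C := 0) (y := y) (z := y / 2) (by nlinarith [sq_nonneg y])
  simpa using this

lemma gauss_shift {x : ℝ} (y : ℝ) (hx : |x| ≤ 3) : gauss (y + x) ≤ Real.exp 2 * gauss (y / 2) := by
  apply gauss_le
  have : x ^ 2 ≤ 9 := by rw [← sq_abs]; nlinarith [abs_nonneg x]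
  nlinarith [sq_nonneg (3 * y + 4 * x)]

lemma cosh_bd (t : ℝ) : 2 ≤ Real.exp t + Real.exp (-t) ∧
    Real.exp t + Real.exp (-t) ≤ 2 + t ^ 2 * Real.exp |t| := by
  have main : ∀ t : ℝ, 0 ≤ t → 2 ≤ Real.exp t + Real.exp (-t) ∧
    Real.exp t + Real.exp (-t) ≤ 2 + t ^ 2 * Real.exp t := by
    intro t ht
    have h1 : Real.exp t * Real.exp (-t) = 1 := by rw [← Real.exp_add]; simp
    have h2 := Real.add_one_le_exp (-t)
    have p1 := Real.exp_pos t
    have p2 := Real.exp_pos (-t)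
    have h3 : 1 ≤ Real.exp t := Real.one_le_exp ht
    have h4 : Real.exp t - 1 ≤ t * Real.exp t := by nlinarith
    generalize Real.exp t = e at *
    generalize Real.exp (-t) = f at *
    have h5 : e + f - 2 = f * (e - 1) ^ 2 := by linear_combination (2 - e) * h1
    have h6 : (e - 1) ^ 2 ≤ (t * e) ^ 2 := by
      apply pow_le_pow_left₀ (by linarith) h4
    have h7 : f * (e - 1) ^ 2 ≤ f * (t * e) ^ 2 := mul_le_mul_of_nonneg_left h6 p2.le
    have h8 : f * (t * e) ^ 2 = t ^ 2 * e := by linear_combination (t ^ 2 * e) * h1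
    have h9 : 0 ≤ f * (e - 1) ^ 2 := by positivity
    constructor <;> linarith
  rcases le_total 0 t with h | h
  · rw [abs_of_nonneg h]; exact main t h
  · have := main (-t) (by linarith)
    rw [neg_neg, neg_sq] at this
    rw [abs_of_nonpos h]
    exact ⟨by linarith, by linarith⟩

lemma second_diff {x : ℝ} (y : ℝ) (hx : |x| ≤ 1) :
    |2 * gauss y - gauss (y - x) - gauss (y + x)| ≤ (2 * Real.exp 3) * x ^ 2 * gauss (y / 2) := by
  have e1 : gauss (y + x) = gauss y * (Real.exp (-(x ^ 2) / 2) * Real.exp (-(x * y))) := by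
    unfold gauss
    rw [mul_assoc, ← Real.exp_add, ← Real.exp_add]; congr 2; ring
  have e2 : gauss (y - x) = gauss y * (Real.exp (-(x ^ 2) / 2) * Real.exp (x * y)) := by
    unfold gauss
    rw [mul_assoc, ← Real.exp_add, ← Real.exp_add]; congr 2; ring
  obtain ⟨c1, c2⟩ := cosh_bd (x * y)
  have g := gauss_pos y
  have gh := gauss_half y
  have hg2 := gauss_pos (y / 2)
  have f1 : Real.exp (-(x ^ 2) / 2) ≤ 1 := Real.exp_le_one_iff.2 (by nlinarith [sq_nonneg x])
  have f0 := Real.exp_pos (-(x ^ 2) / 2)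
  have f2 := Real.add_one_le_exp (-(x ^ 2) / 2)
  have hy2 : y ^ 2 * Real.exp |y| * gauss y ≤ 2 * Real.exp 3 * gauss (y / 2) := by
    have q := pow_le_exp (abs_nonneg y) 2
    norm_num [Nat.factorial] at q
    have h3 : Real.exp |y| * Real.exp |y| * gauss y ≤ Real.exp 3 * gauss (y / 2) := by
      have := gauss_le (C := 3 - 2 * |y|) (y := y) (z := y / 2) (by
        have := sq_abs y
        nlinarith [sq_nonneg (3 * |y| - 8)])
      calc _ ≤ Real.exp |y| * Real.exp |y| * (Real.exp (3 - 2 * |y|) * gauss (y / 2)) := by gcongr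
        _ = (Real.exp |y| * Real.exp |y| * Real.exp (3 - 2 * |y|)) * gauss (y / 2) := by ring
        _ = _ := by
          rw [← Real.exp_add, ← Real.exp_add]; congr 2; ring
    calc _ ≤ 2 * Real.exp |y| * Real.exp |y| * gauss y := by gcongr
      _ ≤ _ := by linarith
  have hxy : Real.exp |x * y| ≤ Real.exp |y| := by
    apply Real.exp_le_exp.2
    rw [abs_mul]; exact mul_le_of_le_one_left (abs_nonneg _) hx
  have c3 : (x * y) ^ 2 * Real.exp |x * y| * gauss y ≤ x ^ 2 * (2 * Real.exp 3 * gauss (y / 2)) := by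
    calc _ ≤ (x * y) ^ 2 * Real.exp |y| * gauss y := by gcongr
      _ = x ^ 2 * (y ^ 2 * Real.exp |y| * gauss y) := by ring
      _ ≤ _ := by gcongr
  have hE : 2 * gauss y - gauss (y - x) - gauss (y + x) =
      gauss y * (2 - Real.exp (-(x ^ 2) / 2) * (Real.exp (x * y) + Real.exp (-(x * y)))) := by
    rw [e1, e2]; ring
  rw [hE]
  have h3 : (1:ℝ) ≤ Real.exp 3 := Real.one_le_exp (by norm_num)
  generalize Real.exp (x * y) + Real.exp (-(x * y)) = E at *
  generalize Real.exp (-(x ^ 2) / 2) = f at *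
  rw [abs_le]
  constructor
  · have : f * E ≤ E := by nlinarith
    have h5 : gauss y * (f * E - 2) ≤ gauss y * ((x * y) ^ 2 * Real.exp |x * y|) := by
      apply mul_le_mul_of_nonneg_left _ g.le
      linarith
    nlinarith
  · have : 2 - f * E ≤ x ^ 2 := by nlinarith
    have h5 : gauss y * (2 - f * E) ≤ gauss (y / 2) * x ^ 2 := by
      calc _ ≤ gauss y * x ^ 2 := by gcongr
        _ ≤ _ := by gcongr
    nlinarith [mul_nonneg hg2.le (sq_nonneg x)]

lemma psi_tail_bd {ψ : ℝ → ℕ → ℝ → ℝ} (hψ : IsPsiFamily ψ) {a b : ℝ} (ha : 0 < a) (hb : b < 2)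
    {l : ℕ} (hl : l ≤ 1) : ∃ B > 0, ∀ α, a ≤ α → α ≤ b → ∀ z, 1 ≤ |z| → ψ α l z ≤ B := by
  obtain ⟨c, hc, C0, hcC⟩ := hψ.unifBound (Icc a b) (fun x hx => ⟨ha.trans_le hx.1, hx.2.trans_lt hb⟩)
    isCompact_Icc l
  refine ⟨|C0| + 1, by positivity, fun α h1 h2 z hz => ?_⟩
  have hα : 0 < α := ha.trans_le h1
  rcases le_total (|z|) 3 with h | h
  · have := (hcC α ⟨h1, h2⟩ z hz h).2
    linarith [le_abs_self C0]
  · rw [hψ.eq_tail α ⟨hα, h2.trans_lt hb⟩ l z h]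
    have hz0 : 0 < |z| := by linarith
    have h3 := log_pow_bd hl |z|
    have h4 : |(Real.log |z|)| = Real.log |z| := abs_of_nonneg (Real.log_nonneg hz)
    have h5 := Real.log_le_sub_one_of_pos hz0
    have h6 : |z| ≤ |z| ^ (α + 1) := by
      rw [Real.rpow_add_one hz0.ne']
      exact le_mul_of_one_le_left hz0.le (Real.one_le_rpow hz hα.le)
    have h7 := le_abs_self (Real.log |z| ^ l)
    have : Real.log |z| ^ l / |z| ^ (α + 1) ≤ 1 := by
      rw [div_le_one (by positivity)]; linarith
    linarith [abs_nonneg C0]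

lemma psi_shift_int {ψ : ℝ → ℕ → ℝ → ℝ} (hψ : IsPsiFamily ψ) {α : ℝ} (h0 : 0 < α) (h2 : α < 2)
    {l : ℕ} (hl : l ≤ 1) (y : ℝ) :
    IntegrableOn (fun z => gauss (y - z) * ψ α l z) {z : ℝ | 1 < |z|} := by
  obtain ⟨B, hB, hb⟩ := psi_tail_bd hψ h0 h2 hl
  have hm : MeasurableSet {z : ℝ | 1 < |z|} := measurableSet_lt measurable_const measurable_norm
  have hc : Continuous (ψ α l) := (hψ.contDiff α ⟨h0, h2⟩ l).continuous
  have hg := gauss_cont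
  have hi := (gauss_integrable.comp_sub_left y).mul_const B
  refine Integrable.mono' hi.integrableOn (by fun_prop) ?_
  refine (ae_restrict_iff' hm).2 (Eventually.of_forall fun z (hz : 1 < |z|) => ?_)
  have hp := hψ.pos α ⟨h0, h2⟩ l z
  rw [norm_mul, Real.norm_of_nonneg (gauss_pos _).le, Real.norm_of_nonneg hp.le]
  exact mul_le_mul_of_nonneg_left (hb α le_rfl le_rfl z hz.le) (gauss_pos _).le

lemma Ical_eq {ψ : ℝ → ℕ → ℝ → ℝ} (hψ : IsPsiFamily ψ) {α : ℝ} (h0 : 0 < α) (h2 : α < 2)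
    {l : ℕ} (hl : l ≤ 1) (y : ℝ) :
    IntegrableOn (fun x => (gauss (y - x) + gauss (y + x)) * ψ α l x) (Ioi 1) ∧
    Ical ψ α 0 l y = ∫ x in Ioi 1, (gauss (y - x) + gauss (y + x)) * ψ α l x := by
  have hI := psi_shift_int hψ h0 h2 hl y
  have hset : {z : ℝ | 1 < |z|} = Iio (-1) ∪ Ioi 1 := by
    ext z
    simp only [mem_ofPred_eq, mem_union, mem_Iio, mem_Ioi, lt_abs]
    constructor
    · rintro (h | h)
      · right; exact h
      · left; linarith
    · rintro (h | h)
      · right; linarith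
      · left; exact h
  have hI' := hI
  rw [hset] at hI'
  have i1 := hI'.mono_set (subset_union_left)
  have i2 := hI'.mono_set (subset_union_right)
  have i3 : IntegrableOn (fun x => gauss (y + x) * ψ α l x) (Ioi 1) := by
    have h := i1.comp_neg
    have hs : -Iio (-1:ℝ) = Ioi 1 := by simp
    rw [hs] at h
    refine h.congr_fun (fun x hx => ?_) measurableSet_Ioi
    simp only [sub_neg_eq_add, hψ.even α ⟨h0, h2⟩ l]
  have i4 : IntegrableOn (fun x => (gauss (y - x) + gauss (y + x)) * ψ α l x) (Ioi 1) := by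
    refine (i2.add i3).congr_fun (fun x hx => ?_) measurableSet_Ioi
    simp only [Pi.add_apply]; ring
  refine ⟨i4, ?_⟩
  have e : Ical ψ α 0 l y = ∫ z in {z : ℝ | 1 < |z|}, gauss (y - z) * ψ α l z := rfl
  have hd : Disjoint (Iio (-1:ℝ)) (Ioi 1) := by
    rw [Set.disjoint_left]
    intro z (h1 : z < -1) (h3 : 1 < z)
    linarith
  rw [e, hset, setIntegral_union hd measurableSet_Ioi i1 i2]
  have h := integral_comp_neg_Ioi (1:ℝ) (fun z => gauss (y - z) * ψ α l z)
  rw [integral_Iic_eq_integral_Iio] at h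
  rw [← h]
  simp only [sub_neg_eq_add, hψ.even α ⟨h0, h2⟩ l]
  rw [add_comm, ← integral_add i2 i3]
  congr 1; funext x; ring

lemma T_Ical {ψ : ℝ → ℕ → ℝ → ℝ} (hψ : IsPsiFamily ψ) {a b : ℝ} (ha : 0 < a) (hab : a ≤ b) (hb : b < 2)
    {l : ℕ} (hl : l ≤ 1) : ∃ C > 0, ∀ α, a ≤ α → α ≤ b → ∀ y,
      |Tint α l y + Ical ψ α 0 l y| ≤ C * gauss (y / 2) := by
  obtain ⟨B, hB, hBb⟩ := psi_tail_bd hψ ha hb hl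
  have hdI := dom_int ha hab hb
  set I := ∫ x in Ioi 0, min 1 (x ^ 2) * dom a b x with hI
  have hI0 : 0 ≤ I := setIntegral_nonneg measurableSet_Ioi fun x (hx : 0 < x) =>
    mul_nonneg (by positivity) (dom_nonneg ha hb hx)
  set M := 2 * Real.exp 3 + 2 + 2 * Real.exp 2 * (9 * B + 1) with hM
  have hM0 : 0 < M := by positivity
  refine ⟨M * I + 1, by positivity, fun α h1 h2 y => ?_⟩
  have p0 : 0 < α := ha.trans_le h1
  have p2 : α < 2 := h2.trans_lt hb
  obtain ⟨i4, hIc⟩ := Ical_eq hψ p0 p2 hl y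
  have hk := ker_meas α l
  have hg := gauss_cont
  have hgy := gauss_pos y
  have hgh := gauss_half y
  have hg2 := gauss_pos (y / 2)
  have hs : ∀ x, |x| ≤ 3 → gauss (y - x) + gauss (y + x) ≤ 2 * Real.exp 2 * gauss (y / 2) := by
    intro x hx
    have e1 := gauss_shift y hx
    have e2 := gauss_shift (x := -x) y (by rwa [abs_neg])
    rw [← sub_eq_add_neg] at e2
    linarith
  -- integrability of the full T integrand
  have iT : IntegrableOn (fun x => (2 * gauss y - gauss (y - x) - gauss (y + x)) * ker α l x) (Ioi 0) := by
    refine Integrable.mono' (hdI.const_mul ((2 * Real.exp 3) * gauss (y / 2) + 2 * gauss y +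
      2 * gauss 0)) (by fun_prop) ?_
    refine (ae_restrict_iff' measurableSet_Ioi).2 (Eventually.of_forall fun x (hx : 0 < x) => ?_)
    rw [norm_mul, Real.norm_eq_abs, Real.norm_eq_abs, ← mul_assoc]
    have hg0 : ∀ z, gauss z ≤ gauss 0 := fun z => by
      have := gauss_le (C := 0) (y := z) (z := 0) (by nlinarith [sq_nonneg z])
      simpa using this
    refine mul_le_mul ?_ (ker_bd hl ha hb h1 h2 hx) (abs_nonneg _) (by
      have := gauss_pos 0
      positivity)
    have z1 := gauss_pos (y - x)
    have z2 := gauss_pos (y + x)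
    have z3 := hg0 (y - x)
    have z4 := hg0 (y + x)
    have z5 := gauss_pos 0
    have z6 : 0 < 2 * Real.exp 3 * gauss (y / 2) := by positivity
    rcases le_total x 1 with h | h
    · rw [min_eq_right (by nlinarith)]
      refine (second_diff y (by rwa [abs_of_pos hx])).trans ?_
      nlinarith [mul_nonneg (sq_nonneg x) hgy.le, mul_nonneg (sq_nonneg x) z5.le]
    · rw [min_eq_left (by nlinarith), abs_le]
      constructor <;> linarith
  have iTa := iT.mono_set (show Ioc (0:ℝ) 1 ⊆ Ioi 0 from Ioc_subset_Ioi_self)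
  have iTb := iT.mono_set (Ioi_subset_Ioi (zero_le_one (α := ℝ)))
  have hsplit : Tint α l y + Ical ψ α 0 l y =
      (∫ x in Ioc 0 1, (2 * gauss y - gauss (y - x) - gauss (y + x)) * ker α l x)
      + ∫ x in Ioi 1, ((2 * gauss y - gauss (y - x) - gauss (y + x)) * ker α l x
        + (gauss (y - x) + gauss (y + x)) * ψ α l x) := by
    have hu : Ioi (0:ℝ) = Ioc 0 1 ∪ Ioi 1 := (Ioc_union_Ioi_eq_Ioi zero_le_one).symm
    rw [integral_add iTb i4, ← hIc, Tint, hu,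
      setIntegral_union (Ioc_disjoint_Ioi le_rfl) measurableSet_Ioi iTa iTb, add_assoc]
  have hda := hdI.mono_set (show Ioc (0:ℝ) 1 ⊆ Ioi 0 from Ioc_subset_Ioi_self)
  have hdb := hdI.mono_set (Ioi_subset_Ioi (zero_le_one (α := ℝ)))
  have hIs : I = (∫ x in Ioc 0 1, min 1 (x ^ 2) * dom a b x) + ∫ x in Ioi 1, min 1 (x ^ 2) * dom a b x := by
    have hu : Ioi (0:ℝ) = Ioc 0 1 ∪ Ioi 1 := (Ioc_union_Ioi_eq_Ioi zero_le_one).symm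
    rw [hI, hu, setIntegral_union (Ioc_disjoint_Ioi le_rfl) measurableSet_Ioi hda hdb]
  have B1 : |∫ x in Ioc 0 1, (2 * gauss y - gauss (y - x) - gauss (y + x)) * ker α l x|
      ≤ ∫ x in Ioc 0 1, M * gauss (y / 2) * (min 1 (x ^ 2) * dom a b x) := by
    rw [← Real.norm_eq_abs]
    refine norm_integral_le_of_norm_le (hda.const_mul _) ?_
    refine (ae_restrict_iff' measurableSet_Ioc).2 (Eventually.of_forall fun x hx => ?_)
    have hx0 : 0 < x := hx.1
    rw [norm_mul, Real.norm_eq_abs, Real.norm_eq_abs, ← mul_assoc]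
    refine mul_le_mul ?_ (ker_bd hl ha hb h1 h2 hx0) (abs_nonneg _) (by positivity)
    rw [min_eq_right (by nlinarith [hx.2])]
    refine (second_diff y (by rw [abs_of_pos hx0]; exact hx.2)).trans ?_
    have : 2 * Real.exp 3 ≤ M := by
      have : 0 ≤ 2 * Real.exp 2 * (9 * B + 1) := by positivity
      linarith
    calc _ ≤ M * x ^ 2 * gauss (y / 2) := by gcongr
      _ = _ := by ring
  have B2 : |∫ x in Ioi 1, ((2 * gauss y - gauss (y - x) - gauss (y + x)) * ker α l x
        + (gauss (y - x) + gauss (y + x)) * ψ α l x)|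
      ≤ ∫ x in Ioi 1, M * gauss (y / 2) * (min 1 (x ^ 2) * dom a b x) := by
    rw [← Real.norm_eq_abs]
    refine norm_integral_le_of_norm_le (hdb.const_mul _) ?_
    refine (ae_restrict_iff' measurableSet_Ioi).2 (Eventually.of_forall fun x (hx : 1 < x) => ?_)
    have hx0 : 0 < x := one_pos.trans hx
    rw [min_eq_left (by nlinarith), one_mul, Real.norm_eq_abs]
    have hkb := ker_bd hl ha hb h1 h2 hx0
    have hd0 := dom_nonneg ha hb hx0
    have hax : |x| = x := abs_of_pos hx0
    have z1 := gauss_pos (y - x)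
    have z2 := gauss_pos (y + x)
    have e : (2 * gauss y - gauss (y - x) - gauss (y + x)) * ker α l x
        + (gauss (y - x) + gauss (y + x)) * ψ α l x
        = 2 * gauss y * ker α l x + (gauss (y - x) + gauss (y + x)) * (ψ α l x - ker α l x) := by ring
    rw [e]
    have t1 : |2 * gauss y * ker α l x| ≤ 2 * gauss (y / 2) * dom a b x := by
      rw [abs_mul, abs_of_pos (by positivity)]
      gcongr
    have t2 : |(gauss (y - x) + gauss (y + x)) * (ψ α l x - ker α l x)|
        ≤ 2 * Real.exp 2 * gauss (y / 2) * ((9 * B + 1) * dom a b x) := by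
      rcases le_total x 3 with h3 | h3
      · have hp := hψ.pos α ⟨p0, p2⟩ l x
        have hpB := hBb α h1 h2 x (by rw [hax]; exact hx.le)
        have hdom : 1 ≤ 9 * dom a b x := by
          have h2b : 0 < 2 - b := by linarith
          have r1 : (x ^ 2)⁻¹ ≤ x ^ (-1 - a / 2) := by
            rw [← Real.rpow_two, ← Real.rpow_neg hx0.le]
            exact Real.rpow_le_rpow_of_exponent_le hx.le (by linarith)
          have r2 : (9:ℝ)⁻¹ ≤ (x ^ 2)⁻¹ := by
            apply inv_anti₀ (by positivity); nlinarith
          have r3 : 0 < x ^ (-1 - (1 + b / 2)) := Real.rpow_pos_of_pos hx0 _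
          have r4 : 0 ≤ 2 / a + 2 / (2 - b) := by positivity
          have r5 : (9:ℝ)⁻¹ ≤ x ^ (-1 - a / 2) + x ^ (-1 - (1 + b / 2)) := by linarith
          unfold dom
          have : (9:ℝ)⁻¹ ≤ (1 + 2 / a + 2 / (2 - b)) * (x ^ (-1 - a / 2) + x ^ (-1 - (1 + b / 2))) := by
            refine r5.trans (le_mul_of_one_le_left (by positivity) (by linarith))
          linarith
        rw [abs_mul, abs_of_pos (by positivity)]
        refine mul_le_mul (hs x (by rw [hax]; exact h3)) ?_ (abs_nonneg _) (by positivity)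
        refine (abs_sub _ _).trans ?_
        rw [abs_of_pos hp]
        nlinarith
      · have : ψ α l x - ker α l x = 0 := by
          rw [hψ.eq_tail α ⟨p0, p2⟩ l x (by rw [hax]; exact h3), hax, ker,
            show -1 - α = -(α + 1) by ring, Real.rpow_neg hx0.le]
          ring
        rw [this, mul_zero, abs_zero]
        positivity
    calc _ ≤ _ := abs_add_le _ _
      _ ≤ 2 * gauss (y / 2) * dom a b x + 2 * Real.exp 2 * gauss (y / 2) * ((9 * B + 1) * dom a b x) :=
        add_le_add t1 t2
      _ = (M - 2 * Real.exp 3) * gauss (y / 2) * dom a b x := by rw [hM]; ring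
      _ ≤ _ := by
        gcongr
        linarith [Real.exp_pos 3]
  rw [hsplit]
  rw [integral_const_mul] at B1 B2
  calc _ ≤ _ := abs_add_le _ _
    _ ≤ _ := add_le_add B1 B2
    _ = M * gauss (y / 2) * I := by rw [hIs]; ring
    _ ≤ _ := by nlinarith



lemma f_dec {α w M : ℝ} (h0 : 0 < α) (hw : 0 < w) (y : ℝ)
    (hE : Eul (fun u => u ^ α * Real.exp (-u)) M (fun u => Real.exp (-(u ^ 2) / 2) *
      (Real.exp (-(w ^ α * u ^ α)) - 1 + w ^ α * u ^ α))) :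
    fFun α y w - gauss y = -(w ^ α) * Vint α 0 y + Real.pi⁻¹ * ∫ u in Ioi 0, Real.cos (y * u) *
      (Real.exp (-(u ^ 2) / 2) * (Real.exp (-(w ^ α * u ^ α)) - 1 + w ^ α * u ^ α)) := by
  have iR := hE.cos_int h0 y
  have iV := Vint_int (l := 0) (by norm_num) h0 y
  have iC := cosg_int y
  have key : (∫ u in Ioi 0, Real.cos (y * u) * Real.exp (-(u ^ 2) / 2) * Real.exp (-((w * u) ^ α)))
      = ((∫ u in Ioi 0, Real.cos (y * u) * Real.exp (-(u ^ 2) / 2)) - w ^ α * ∫ u in Ioi 0,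
        Real.cos (y * u) * (Real.exp (-(u ^ 2) / 2) * (u ^ α * Real.log u ^ 0)))
        + ∫ u in Ioi 0, Real.cos (y * u) *
      (Real.exp (-(u ^ 2) / 2) * (Real.exp (-(w ^ α * u ^ α)) - 1 + w ^ α * u ^ α)) := by
    have iS : IntegrableOn (fun u : ℝ => Real.cos (y * u) * Real.exp (-(u ^ 2) / 2) - w ^ α *
        (Real.cos (y * u) * (Real.exp (-(u ^ 2) / 2) * (u ^ α * Real.log u ^ 0)))) (Ioi 0) :=
      iC.sub (iV.const_mul _)
    rw [← integral_const_mul, ← integral_sub iC (iV.const_mul _), ← integral_add iS iR]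
    refine setIntegral_congr_fun measurableSet_Ioi fun u (hu : 0 < u) => ?_
    simp only [Real.mul_rpow hw.le hu.le, pow_zero, Pi.sub_apply]
    ring
  rw [fFun_rep h0 hw, gauss_rep, Vint, key]
  ring

lemma g_dec {α w M : ℝ} (h0 : 0 < α) (hw : 0 < w) (y : ℝ)
    (hE : Eul (fun u => u ^ α * Real.exp (-u)) M (fun u => Real.exp (-(u ^ 2) / 2) *
      (u ^ 2 * (1 - Real.exp (-(w ^ α * u ^ α)))))) :
    gFun α y w - Dop gauss y = - (Real.pi⁻¹ * ∫ u in Ioi 0, Real.cos (y * u) *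
      (Real.exp (-(u ^ 2) / 2) * (u ^ 2 * (1 - Real.exp (-(w ^ α * u ^ α)))))) := by
  have iR := hE.cos_int h0 y
  have iC : IntegrableOn (fun u : ℝ => Real.cos (y * u) * (u ^ 2 * Real.exp (-(u ^ 2) / 2))) (Ioi 0) := by
    refine Integrable.mono' (rpow_gauss_int (q := 2) (by norm_num)) (by fun_prop)
      (Eventually.of_forall fun u => ?_)
    rw [norm_mul, Real.norm_eq_abs, Real.norm_of_nonneg (by positivity), Real.rpow_two,
      mul_comm (Real.exp _)]
    exact mul_le_of_le_one_left (by positivity) (Real.abs_cos_le_one _)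
  have key : (∫ u in Ioi 0, Real.cos (y * u) * (u ^ 2 * Real.exp (-(u ^ 2) / 2)) * Real.exp (-((w * u) ^ α)))
      = (∫ u in Ioi 0, Real.cos (y * u) * (u ^ 2 * Real.exp (-(u ^ 2) / 2)))
        - ∫ u in Ioi 0, Real.cos (y * u) *
      (Real.exp (-(u ^ 2) / 2) * (u ^ 2 * (1 - Real.exp (-(w ^ α * u ^ α))))) := by
    rw [← integral_sub iC iR]
    refine setIntegral_congr_fun measurableSet_Ioi fun u (hu : 0 < u) => ?_
    simp only [Real.mul_rpow hw.le hu.le]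
    ring
  rw [gFun_rep h0 hw, Dgauss_rep, key]
  ring

lemma h_dec {α w M : ℝ} (h0 : 0 < α) (hw : 0 < w) (y : ℝ)
    (hE : Eul (fun u => u ^ α * Real.exp (-u)) M (fun u => Real.exp (-(u ^ 2) / 2) *
      (w ^ α * u ^ α * (1 - Real.exp (-(w ^ α * u ^ α)))))) :
    hFun α y w = α * (w ^ α * Vint α 0 y) - α * (Real.pi⁻¹ * ∫ u in Ioi 0, Real.cos (y * u) *
      (Real.exp (-(u ^ 2) / 2) * (w ^ α * u ^ α * (1 - Real.exp (-(w ^ α * u ^ α)))))) := by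
  have iR := hE.cos_int h0 y
  have iV := Vint_int (l := 0) (by norm_num) h0 y
  have key : (∫ u in Ioi 0, Real.cos (y * u) * Real.exp (-(u ^ 2) / 2) *
        (α * ((w * u) ^ α * Real.exp (-((w * u) ^ α)))))
      = α * ((w ^ α * ∫ u in Ioi 0,
        Real.cos (y * u) * (Real.exp (-(u ^ 2) / 2) * (u ^ α * Real.log u ^ 0)))
        - ∫ u in Ioi 0, Real.cos (y * u) *
      (Real.exp (-(u ^ 2) / 2) * (w ^ α * u ^ α * (1 - Real.exp (-(w ^ α * u ^ α)))))) := by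
    rw [← integral_const_mul, ← integral_sub (iV.const_mul _) iR, ← integral_const_mul]
    refine setIntegral_congr_fun measurableSet_Ioi fun u (hu : 0 < u) => ?_
    simp only [Real.mul_rpow hw.le hu.le, pow_zero]
    ring
  rw [hFun_rep h0 hw, Vint, key]
  ring

lemma k_dec {α w M : ℝ} (h0 : 0 < α) (hw : 0 < w) (y : ℝ)
    (hE : Eul (fun u => u ^ α * Real.exp (-u)) M (fun u => Real.exp (-(u ^ 2) / 2) *
      ((w ^ α * u ^ α * (1 - Real.exp (-(w ^ α * u ^ α)))) * (Real.log u + Real.log w)))) :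
    kFun α y w = -(w ^ α * Vint α 1 y) - w ^ α * Real.log w * Vint α 0 y
      + Real.pi⁻¹ * ∫ u in Ioi 0, Real.cos (y * u) *
      (Real.exp (-(u ^ 2) / 2) *
      ((w ^ α * u ^ α * (1 - Real.exp (-(w ^ α * u ^ α)))) * (Real.log u + Real.log w))) := by
  have iR := hE.cos_int h0 y
  have iV := Vint_int (l := 0) (by norm_num) h0 y
  have iV1 := Vint_int (l := 1) le_rfl h0 y
  have key : (∫ u in Ioi 0, Real.cos (y * u) * Real.exp (-(u ^ 2) / 2) *
        ((w * u) ^ α * Real.log (w * u) * Real.exp (-((w * u) ^ α))))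
      = ((w ^ α * ∫ u in Ioi 0,
        Real.cos (y * u) * (Real.exp (-(u ^ 2) / 2) * (u ^ α * Real.log u ^ 1)))
        + (w ^ α * Real.log w) * ∫ u in Ioi 0,
        Real.cos (y * u) * (Real.exp (-(u ^ 2) / 2) * (u ^ α * Real.log u ^ 0)))
        - ∫ u in Ioi 0, Real.cos (y * u) *
      (Real.exp (-(u ^ 2) / 2) *
      ((w ^ α * u ^ α * (1 - Real.exp (-(w ^ α * u ^ α)))) * (Real.log u + Real.log w))) := by
    have iS : IntegrableOn (fun u : ℝ => w ^ α *
        (Real.cos (y * u) * (Real.exp (-(u ^ 2) / 2) * (u ^ α * Real.log u ^ 1))) +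
        w ^ α * Real.log w *
        (Real.cos (y * u) * (Real.exp (-(u ^ 2) / 2) * (u ^ α * Real.log u ^ 0)))) (Ioi 0) :=
      (iV1.const_mul _).add (iV.const_mul _)
    rw [← integral_const_mul, ← integral_const_mul, ← integral_add (iV1.const_mul _) (iV.const_mul _),
      ← integral_sub iS iR]
    refine setIntegral_congr_fun measurableSet_Ioi fun u (hu : 0 < u) => ?_
    simp only [Real.mul_rpow hw.le hu.le, Real.log_mul hw.ne' hu.ne', pow_zero, pow_one, Pi.add_apply]
    ring
  rw [kFun_rep h0 hw, Vint, Vint, key]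
  ring

lemma pi_inv_mul_le {I D : ℝ} (h : |I| ≤ D) : |Real.pi⁻¹ * I| ≤ D := by
  rw [abs_mul, abs_of_pos (by have := Real.pi_pos; positivity)]
  have : Real.pi⁻¹ ≤ 1 := inv_le_one_of_one_le₀ (by linarith [Real.pi_gt_three])
  exact (mul_le_of_le_one_left (abs_nonneg _) this).trans h

set_option maxHeartbeats 1000000 in
/-- first-order approximations for `f_α, g_α, h_α, k_α`. -/
theorem statement7 (K : Set ℝ) (hK : IsCompact K) (hKsub : K ⊆ Set.Ioo (0 : ℝ) 2)
    (ψ : ℝ → ℕ → ℝ → ℝ) (hψ : IsPsiFamily ψ) :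
    ∃ C > (0 : ℝ), ∀ α ∈ K, ∀ w ∈ Set.Ioc (0 : ℝ) (1 / 3), ∀ y : ℝ,
      |fFun α y w - gauss y - cAlpha α * w ^ α * Ical ψ α 0 0 y| ≤
        C * (w ^ α * gauss (y / 2) + w ^ (2 * α) * ψ α 0 y) ∧
      |gFun α y w - Dop gauss y| ≤ C * w ^ α * ψ α 0 y ∧
      |hFun α y w + α * cAlpha α * w ^ α * Ical ψ α 0 0 y| ≤
        C * (w ^ α * gauss (y / 2) + w ^ (2 * α) * ψ α 0 y) ∧
      |kFun α y w + cAlpha α * w ^ α * Real.log (1 / w) * Ical ψ α 0 0 y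
          + cAlpha α * w ^ α * Ical ψ α 0 1 y
          - deriv cAlpha α * w ^ α * Ical ψ α 0 0 y| ≤
        C * w ^ α * (Real.log (1 / w) * (gauss (y / 2) + w ^ α * ψ α 0 y)
          + w ^ α * ψ α 1 y) := by
  rcases K.eq_empty_or_nonempty with rfl | hne
  · exact ⟨1, one_pos, fun α hα => absurd hα (Set.notMem_empty α)⟩
  obtain ⟨a, haK, haL⟩ := hK.exists_isLeast hne
  obtain ⟨b, hbK, hbG⟩ := hK.exists_isGreatest hne
  have ha : 0 < a := (hKsub haK).1
  have hb : b < 2 := (hKsub hbK).2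
  have hab : a ≤ b := haL hbK
  obtain ⟨Mf, hMf, hf⟩ := rem_f
  obtain ⟨Mg, hMg, hg⟩ := rem_g
  obtain ⟨Mh, hMh, hh⟩ := rem_h
  obtain ⟨Mk, hMk, hk⟩ := rem_k ha
  obtain ⟨Cd, hCd, hd⟩ := decay_psi ha hb ψ hψ
  obtain ⟨B, hB, hcB⟩ := c_bdd ha hab hb
  obtain ⟨C0, hC0, hT0⟩ := T_Ical hψ ha hab hb (l := 0) (by norm_num)
  obtain ⟨C1, hC1, hT1⟩ := T_Ical hψ ha hab hb (l := 1) le_rfl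
  obtain ⟨C, hC⟩ : ∃ C, C = 2 * (2 * (B * C0) + B * C1) + 2 * (Cd * Mf + Cd * Mg + Cd * Mh + Cd * Mk) :=
    ⟨_, rfl⟩
  have q1 : 0 < B * C0 := by positivity
  have q2 : 0 < B * C1 := by positivity
  have q3 : 0 < Cd * Mf := by positivity
  have q4 : 0 < Cd * Mg := by positivity
  have q5 : 0 < Cd * Mh := by positivity
  have q6 : 0 < Cd * Mk := by positivity
  refine ⟨C, by rw [hC]; positivity, fun α hα w hw y => ?_⟩
  have h1 : a ≤ α := haL hα
  have h2 : α ≤ b := hbG hα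
  have p0 : 0 < α := ha.trans_le h1
  have p2 : α < 2 := h2.trans_lt hb
  have hw0 : 0 < w := hw.1
  have hL := one_le_log_inv hw0 hw.2
  have hs : 0 < w ^ α := Real.rpow_pos_of_pos hw0 _
  have hs2 : w ^ (2 * α) = w ^ α * w ^ α := by
    rw [← Real.rpow_add hw0]; congr 1; ring
  have hlog : Real.log w = -Real.log (1 / w) := by rw [one_div, Real.log_inv, neg_neg]
  have hψ0 := hψ.pos α ⟨p0, p2⟩ 0 y
  have hψ1 := hψ.pos α ⟨p0, p2⟩ 1 y
  have hG := gauss_pos (y / 2)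
  obtain ⟨hc, hc'⟩ := hcB α h1 h2
  have t0 := hT0 α h1 h2 y
  have t1 := hT1 α h1 h2 y
  have ef := hf α (w ^ α) p0.le p2.le hs.le
  have eg := hg α (w ^ α) p0.le p2.le hs.le
  have eh := hh α (w ^ α) p0.le p2.le hs.le
  have ek := hk α (w ^ α) w h1 p2.le hs.le hw0 hw.2
  have df := f_dec p0 hw0 y ef
  have dg := g_dec p0 hw0 y eg
  have dh := h_dec p0 hw0 y eh
  have dk := k_dec p0 hw0 y ek
  have bf := pi_inv_mul_le (hd α h1 h2 _ _ ef y)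
  have bg := pi_inv_mul_le (hd α h1 h2 _ _ eg y)
  have bh := pi_inv_mul_le (hd α h1 h2 _ _ eh y)
  have bk := pi_inv_mul_le (hd α h1 h2 _ _ ek y)
  rw [df, dg, dh, dk, hs2, hlog, V1_c p0 p2, V0_c p0 p2]
  rw [hlog] at bk
  generalize Real.pi⁻¹ * _ = Rf at bf ⊢
  generalize Real.pi⁻¹ * _ = Rg at bg ⊢
  generalize Real.pi⁻¹ * _ = Rh at bh ⊢
  generalize Real.pi⁻¹ * _ = Rk at bk ⊢
  clear df dg dh dk ef eg eh ek hs2 hlog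
  generalize w ^ α = s at *
  generalize Real.log (1 / w) = L at *
  generalize gauss (y / 2) = G at *
  generalize ψ α 0 y = P at *
  generalize ψ α 1 y = P1 at *
  generalize cAlpha α = c at *
  generalize deriv cAlpha α = c' at *
  generalize Tint α 0 y = T0 at *
  generalize Tint α 1 y = T1 at *
  generalize Ical ψ α 0 0 y = I0 at *
  generalize Ical ψ α 0 1 y = I1 at *
  have m0 : |c * (T0 + I0)| ≤ B * C0 * G := by
    rw [abs_mul, mul_assoc]; exact mul_le_mul hc t0 (abs_nonneg _) hB.le
  have m0' : |c' * (T0 + I0)| ≤ B * C0 * G := by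
    rw [abs_mul, mul_assoc]; exact mul_le_mul hc' t0 (abs_nonneg _) hB.le
  have m1 : |c * (T1 + I1)| ≤ B * C1 * G := by
    rw [abs_mul, mul_assoc]; exact mul_le_mul hc t1 (abs_nonneg _) hB.le
  have n0 : |s * (c * (T0 + I0))| ≤ s * (B * C0 * G) := by
    rw [abs_mul, abs_of_pos hs]; exact mul_le_mul_of_nonneg_left m0 hs.le
  have n0' : |s * (c' * (T0 + I0))| ≤ s * (B * C0 * G) := by
    rw [abs_mul, abs_of_pos hs]; exact mul_le_mul_of_nonneg_left m0' hs.le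
  have n1 : |s * (c * (T1 + I1))| ≤ s * (B * C1 * G) := by
    rw [abs_mul, abs_of_pos hs]; exact mul_le_mul_of_nonneg_left m1 hs.le
  have nL : |L * (s * (c * (T0 + I0)))| ≤ L * (s * (B * C0 * G)) := by
    rw [abs_mul, abs_of_pos (by linarith)]; exact mul_le_mul_of_nonneg_left n0 (by linarith)
  have hsG : 0 < s * G := by positivity
  have hssP : 0 < s * s * P := by positivity
  have hsP : 0 < s * P := by positivity
  -- dominating pieces
  have k1 : (B * C0) * (s * G) * 2 ≤ C * (s * G) := by
    have : B * C0 * 2 ≤ C := by rw [hC]; linarith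
    have := mul_le_mul_of_nonneg_right this hsG.le
    linarith
  have x1 : 0 < (B * C0) * (s * G) := by positivity
  have x2 : 0 < (Cd * Mf) * (s * s * P) := by positivity
  have k2 : 2 * (Cd * Mf) * (s * s * P) ≤ C * (s * s * P) := by
    have : 2 * (Cd * Mf) ≤ C := by rw [hC]; linarith
    exact mul_le_mul_of_nonneg_right this hssP.le
  have k3 : 2 * (Cd * Mh) * (s * s * P) ≤ C * (s * s * P) := by
    have : 2 * (Cd * Mh) ≤ C := by rw [hC]; linarith
    exact mul_le_mul_of_nonneg_right this hssP.le
  have k4 : Cd * Mg * (s * P) ≤ C * (s * P) := by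
    have : Cd * Mg ≤ C := by rw [hC]; linarith
    exact mul_le_mul_of_nonneg_right this hsP.le
  have hα2 : ∀ X : ℝ, |α * X| ≤ 2 * |X| := fun X => by
    rw [abs_mul, abs_of_pos p0]; exact mul_le_mul_of_nonneg_right p2.le (abs_nonneg _)
  refine ⟨?_, ?_, ?_, ?_⟩
  · have e : -s * (c * T0) + Rf - c * s * I0 = -(s * (c * (T0 + I0))) + Rf := by ring
    rw [e]
    refine (abs_add_le _ _).trans ?_
    rw [abs_neg]
    linarith
  · rw [abs_neg]
    linarith
  · have e : α * (s * (c * T0)) - α * Rh + α * c * s * I0 = α * (s * (c * (T0 + I0)) - Rh) := by ring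
    rw [e]
    refine (hα2 _).trans ?_
    have := abs_sub (s * (c * (T0 + I0))) Rh
    linarith
  · have e : -(s * (c' * T0 - c * T1)) - s * -L * (c * T0) + Rk + c * s * L * I0 + c * s * I1 - c' * s * I0
        = (L * (s * (c * (T0 + I0))) - s * (c' * (T0 + I0))) + (s * (c * (T1 + I1)) + Rk) := by ring
    rw [e]
    have u1 := abs_add_le (L * (s * (c * (T0 + I0))) - s * (c' * (T0 + I0))) (s * (c * (T1 + I1)) + Rk)
    have u2 := abs_sub (L * (s * (c * (T0 + I0)))) (s * (c' * (T0 + I0)))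
    have u3 := abs_add_le (s * (c * (T1 + I1))) Rk
    have v0 : s * (B * C0 * G) ≤ L * (s * (B * C0 * G)) := le_mul_of_one_le_left (by positivity) hL
    have v1 : s * (B * C1 * G) ≤ L * (s * (B * C1 * G)) := le_mul_of_one_le_left (by positivity) hL
    have w1 : (2 * (B * C0) + B * C1) * (L * (s * G)) ≤ C * (L * (s * G)) := by
      refine mul_le_mul_of_nonneg_right (by rw [hC]; linarith) (by positivity)
    have w2 : Cd * Mk * (L * (s * s * P)) ≤ C * (L * (s * s * P)) := by
      refine mul_le_mul_of_nonneg_right (by rw [hC]; linarith) (by positivity)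
    have w3 : 0 ≤ C * s * (s * P1) := by
      have : 0 < C := by rw [hC]; positivity
      positivity
    calc _ ≤ L * (s * (B * C0 * G)) + s * (B * C0 * G) + (s * (B * C1 * G) + |Rk|) := by linarith
      _ ≤ (2 * (B * C0) + B * C1) * (L * (s * G)) + Cd * Mk * (L * (s * s * P)) := by linarith
      _ ≤ C * (L * (s * G)) + C * (L * (s * s * P)) + C * s * (s * P1) := by linarith
      _ = _ := by ring


end LevyLAN
end
end
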